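/- Fix an entire function F : ℂ → ℂ that does not vanish on ℂ \ {0}, a function W : (0,∞) → ℝ with W(w) − w = O(w²) as w → 0⁺, and τ ∈ ℂ; set z(w) = (1 − τ·w^{2/3})/(e·w). Then, as w → 0⁺, φ_0(z(w), w, W(w); F) = √(2π) · 2^{1/3} · w^{−1/6} · K_0(τ, w) · exp(−1/(2w) + τ/w^{1/3}), where K_0(τ, w) = F(1)·Ai(2^{1/3}τ) + w^{1/3}·( (5/6)·τ²·F(1)·Ai(2^{1/3}τ) − (1/6)·2^{1/3}·F(1)·Ai'(2^{1/3}τ) + 2^{1/3}·F'(1)·Ai'(2^{1/3}τ) ) + O(w^{2/3}). -/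

import Mathlib

open Filter Topology

/-- The contour `Π(π/3)`. -/
noncomputable def airyPath (φ : ℝ) (s : ℝ) : ℂ :=
  if s ≤ -1 then -Complex.exp (-(φ : ℂ) * Complex.I) * (s : ℂ)
  else if s ≤ 1 then (Real.cos φ : ℂ) + Complex.I * (s : ℂ) * (Real.sin φ : ℂ)
  else Complex.exp ((φ : ℂ) * Complex.I) * (s : ℂ)

/-- The piecewise derivative of the contour `Π(φ)`. -/
noncomputable def airyPathDeriv (φ : ℝ) (s : ℝ) : ℂ :=
  if s ≤ -1 then -Complex.exp (-(φ : ℂ) * Complex.I)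
  else if s ≤ 1 then Complex.I * (Real.sin φ : ℂ)
  else Complex.exp ((φ : ℂ) * Complex.I)

/-- The Airy function `Ai(z) = (1/(2πi)) ∫_{Π(π/3)} e^{−zt + t³/3} dt`. -/
noncomputable def airyAi (z : ℂ) : ℂ :=
  (1 / (2 * (Real.pi : ℂ) * Complex.I)) *
    ∫ s : ℝ, Complex.exp (-z * airyPath (Real.pi / 3) s + (airyPath (Real.pi / 3) s) ^ 3 / 3) *
      airyPathDeriv (Real.pi / 3) s

/-- The derivative `Ai'` of the Airy function. -/
noncomputable def airyAi' (z : ℂ) : ℂ := deriv airyAi z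

/-- `φ_r(z, w, w⁺; F)`. -/
noncomputable def phiR (r : ℤ) (z : ℂ) (w wp : ℝ) (F : ℂ → ℂ) : ℂ :=
  (1 / (Real.sqrt (2 * Real.pi * w) : ℂ)) *
    ∫ x : ℝ, (1 - z * (wp : ℂ) * Complex.exp (-Complex.I * (x : ℂ))) ^ r *
      Complex.exp (-(x : ℂ) ^ 2 / (2 * (w : ℂ)) - z * Complex.exp (-Complex.I * (x : ℂ))) *
      F (z * (wp : ℂ) * Complex.exp (-Complex.I * (x : ℂ)))

open MeasureTheory

/-- Taylor's estimate for the exponential, with a constant that only sees `Re ζ`. -/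
theorem Complex.norm_exp_sub_sum_le_max_mul (ζ : ℂ) (n : ℕ) :
    ‖Complex.exp ζ - ∑ k ∈ Finset.range n, ζ ^ k / (k.factorial : ℂ)‖ ≤
      max 1 (Real.exp ζ.re) * (‖ζ‖ ^ n / n.factorial) := by
  set M : ℝ := max 1 (Real.exp ζ.re)
  have key : ∀ n : ℕ, ∀ s ∈ Set.Icc (0 : ℝ) 1,
      ‖Complex.exp (s * ζ) - ∑ k ∈ Finset.range n, (s * ζ) ^ k / (k.factorial : ℂ)‖ ≤
        M * (‖ζ‖ ^ n * s ^ n / n.factorial) := by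
    intro n
    induction n with
    | zero =>
      intro s hs
      have h1 : Real.exp (s * ζ.re) ≤ M := by
        rcases le_total ζ.re 0 with h | h
        · exact (Real.exp_le_one_iff.2 (mul_nonpos_of_nonneg_of_nonpos hs.1 h)).trans
            (le_max_left _ _)
        · exact (Real.exp_le_exp.2 (mul_le_of_le_one_left h hs.2)).trans (le_max_right _ _)
      simpa [Complex.norm_exp] using h1
    | succ n ih =>
      have hd : ∀ s : ℝ, HasDerivAt (fun s : ℝ => Complex.exp (s * ζ) -
          ∑ k ∈ Finset.range (n + 1), (s * ζ) ^ k / (k.factorial : ℂ))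
          (ζ * (Complex.exp (s * ζ) -
            ∑ k ∈ Finset.range n, (s * ζ) ^ k / (k.factorial : ℂ))) s := by
        intro s
        have hs : HasDerivAt (fun s : ℝ => (s : ℂ) * ζ) ζ s := by
          simpa using (Complex.ofRealCLM.hasDerivAt (x := s)).mul_const ζ
        have h2 := hs.cexp.sub (HasDerivAt.fun_sum (u := Finset.range (n + 1))
          (fun k _ => (hs.fun_pow k).div_const (k.factorial : ℂ)))
        refine h2.congr_deriv (Eq.symm ?_)
        rw [Finset.sum_range_succ', mul_sub, Finset.mul_sum]
        simp only [Nat.cast_zero, zero_mul, zero_div, add_zero]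
        congr 1
        · ring
        · refine Finset.sum_congr rfl fun k _ => ?_
          have hk : (k.factorial : ℂ) ≠ 0 := by exact_mod_cast k.factorial_ne_zero
          have hk' : (k : ℂ) + 1 ≠ 0 := by exact_mod_cast k.succ_ne_zero
          rw [Nat.factorial_succ]
          push_cast
          field_simp
      have hB : ∀ s : ℝ, HasDerivAt
          (fun s : ℝ => M * (‖ζ‖ ^ (n + 1) * s ^ (n + 1) / (n + 1).factorial))
          (‖ζ‖ * (M * (‖ζ‖ ^ n * s ^ n / n.factorial))) s := by
        intro s
        have h2 := (((hasDerivAt_pow (n + 1) s).const_mul (‖ζ‖ ^ (n + 1))).div_const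
          ((n + 1).factorial : ℝ)).const_mul M
        refine h2.congr_deriv (Eq.symm ?_)
        have hk : (n.factorial : ℝ) ≠ 0 := by exact_mod_cast n.factorial_ne_zero
        have hk' : (n : ℝ) + 1 ≠ 0 := by exact_mod_cast n.succ_ne_zero
        rw [Nat.factorial_succ]
        push_cast
        field_simp
        ring
      refine image_norm_le_of_norm_deriv_right_le_deriv_boundary
        (fun s _ => (hd s).continuousAt.continuousWithinAt)
        (fun s _ => (hd s).hasDerivWithinAt) ?_ hB fun s hs => ?_
      · simp [Finset.sum_range_succ']
      · rw [norm_mul]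
        exact mul_le_mul_of_nonneg_left (ih s ⟨hs.1, hs.2.le⟩) (norm_nonneg _)
  simpa using key n 1 (by simp)

theorem Complex.norm_exp_sub_sum_le_of_re_nonpos {ζ : ℂ} (hζ : ζ.re ≤ 0) (n : ℕ) :
    ‖Complex.exp ζ - ∑ k ∈ Finset.range n, ζ ^ k / (k.factorial : ℂ)‖ ≤
      ‖ζ‖ ^ n / n.factorial := by
  simpa [max_eq_left (Real.exp_le_one_iff.2 hζ)] using
    Complex.norm_exp_sub_sum_le_max_mul ζ n

/-- Second-order Taylor estimate for an entire function on a disc. -/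
theorem Differentiable.exists_norm_sub_sub_deriv_mul_le {F : ℂ → ℂ} (hF : Differentiable ℂ F)
    (a : ℂ) (R : ℝ) :
    ∃ L : ℝ, 0 ≤ L ∧ ∀ p : ℂ, ‖p‖ ≤ R → ‖F p - F a - _root_.deriv F a * (p - a)‖ ≤ L * ‖p - a‖ ^ 2 := by
  have hd : ∀ f : ℂ → ℂ, Differentiable ℂ f → Differentiable ℂ (dslope f a) := fun f hf =>
    differentiableOn_univ.1 ((Complex.differentiableOn_dslope Filter.univ_mem).2
      hf.differentiableOn)
  obtain ⟨L, hL⟩ := (isCompact_closedBall (0 : ℂ) R).exists_bound_of_continuousOn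
    (hd _ (hd F hF)).continuous.continuousOn
  refine ⟨max L 0, le_max_right _ _, fun p hp => ?_⟩
  have h1 := sub_smul_dslope F a p
  have h2 := sub_smul_dslope (dslope F a) a p
  simp only [smul_eq_mul, dslope_same] at h1 h2
  have h3 : F p - F a - _root_.deriv F a * (p - a) =
      dslope (dslope F a) a p * (p - a) ^ 2 := by
    linear_combination -h1 - (p - a) * h2
  rw [h3, norm_mul, norm_pow]
  gcongr
  exact (hL p (by simpa using hp)).trans (le_max_left _ _)

/-- A polynomial times a shifted Gaussian is dominated by a wider Gaussian. -/
theorem exists_one_add_abs_pow_mul_exp_le (N : ℕ) (A B : ℝ) :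
    ∃ C : ℝ, ∀ s : ℝ, (1 + |s|) ^ N * Real.exp (A - s ^ 2 / 8 + B * (1 + |s|)) ≤
      C * Real.exp (-(1 / 16) * s ^ 2) := by
  refine ⟨N.factorial * Real.exp (A + (B + 1) + 4 * (B + 1) ^ 2), fun s => ?_⟩
  have h1 : (1 + |s|) ^ N ≤ N.factorial * Real.exp (1 + |s|) := by
    have := Real.pow_div_factorial_le_exp (x := 1 + |s|) (by positivity) N
    rwa [div_le_iff₀ (by positivity), mul_comm] at this
  calc _ ≤ N.factorial * Real.exp (1 + |s|) * Real.exp (A - s ^ 2 / 8 + B * (1 + |s|)) := by gcongr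
    _ ≤ _ := by
      rw [mul_assoc, mul_assoc, ← Real.exp_add, ← Real.exp_add]
      refine mul_le_mul_of_nonneg_left (Real.exp_le_exp.2 ?_) (by positivity)
      nlinarith [sq_nonneg (|s| / 4 - 2 * (B + 1)), sq_abs s]

theorem integrable_one_add_abs_pow_mul_exp (N : ℕ) (A B : ℝ) :
    Integrable fun s : ℝ => (1 + |s|) ^ N * Real.exp (A - s ^ 2 / 8 + B * (1 + |s|)) := by
  obtain ⟨C, hC⟩ := exists_one_add_abs_pow_mul_exp_le N A B
  refine ((integrable_exp_neg_mul_sq (b := 1 / 16) (by norm_num)).const_mul C).mono'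
    (by fun_prop) (Eventually.of_forall fun s => ?_)
  rw [Real.norm_of_nonneg (by positivity)]
  exact hC s

theorem airyPath_pi_div_three (s : ℝ) :
    airyPath (Real.pi / 3) s = ⟨max 1 |s| / 2, Real.sqrt 3 / 2 * s⟩ := by
  have h1 : Complex.exp (((Real.pi / 3 : ℝ) : ℂ) * Complex.I) = ⟨1 / 2, Real.sqrt 3 / 2⟩ := by
    apply Complex.ext
    · rw [Complex.exp_ofReal_mul_I_re, Real.cos_pi_div_three]
    · rw [Complex.exp_ofReal_mul_I_im, Real.sin_pi_div_three]
  have h2 : Complex.exp (-((Real.pi / 3 : ℝ) : ℂ) * Complex.I) =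
      ⟨1 / 2, -(Real.sqrt 3 / 2)⟩ := by
    rw [← Complex.ofReal_neg]
    apply Complex.ext
    · rw [Complex.exp_ofReal_mul_I_re, Real.cos_neg, Real.cos_pi_div_three]
    · rw [Complex.exp_ofReal_mul_I_im, Real.sin_neg, Real.sin_pi_div_three]
  unfold airyPath
  rw [h1, h2, Real.cos_pi_div_three, Real.sin_pi_div_three]
  split_ifs with h h'
  · rw [abs_of_nonpos (by linarith), max_eq_right (by linarith)]
    apply Complex.ext <;> simp [div_eq_mul_inv, mul_comm]
  · rw [max_eq_left (abs_le.2 ⟨by linarith, h'⟩)]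
    apply Complex.ext <;> simp [div_eq_mul_inv, mul_comm]
  · rw [abs_of_nonneg (by linarith), max_eq_right (by linarith)]
    apply Complex.ext <;> simp [div_eq_mul_inv, mul_comm]

theorem re_airyPath (s : ℝ) : (airyPath (Real.pi / 3) s).re = max 1 |s| / 2 := by
  rw [airyPath_pi_div_three]

theorem im_airyPath (s : ℝ) : (airyPath (Real.pi / 3) s).im = Real.sqrt 3 / 2 * s := by
  rw [airyPath_pi_div_three]

theorem norm_airyPath_of_one_le_abs {s : ℝ} (hs : 1 ≤ |s|) :
    ‖airyPath (Real.pi / 3) s‖ = |s| := by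
  rw [← Real.sqrt_sq (abs_nonneg s), Complex.norm_def, Complex.normSq_apply, re_airyPath,
    im_airyPath, max_eq_right hs]
  congr 1
  nlinarith [Real.sq_sqrt (show (0 : ℝ) ≤ 3 by norm_num), sq_abs s]

theorem norm_airyPath_le_one {s : ℝ} (hs : |s| ≤ 1) : ‖airyPath (Real.pi / 3) s‖ ≤ 1 := by
  rw [← Real.sqrt_one, Complex.norm_def, Complex.normSq_apply, re_airyPath,
    im_airyPath, max_eq_left hs]
  refine Real.sqrt_le_sqrt ?_
  nlinarith [Real.sq_sqrt (show (0 : ℝ) ≤ 3 by norm_num), (sq_le_one_iff_abs_le_one s).2 hs]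

theorem norm_airyPath_le (s : ℝ) : ‖airyPath (Real.pi / 3) s‖ ≤ 1 + |s| := by
  rcases le_total 1 |s| with h | h
  · rw [norm_airyPath_of_one_le_abs h]; linarith
  · exact (norm_airyPath_le_one h).trans (by linarith [abs_nonneg s])

theorem re_airyPath_cube {s : ℝ} (hs : 1 ≤ |s|) :
    (airyPath (Real.pi / 3) s ^ 3).re = -|s| ^ 3 := by
  have h3 := Real.sq_sqrt (show (0 : ℝ) ≤ 3 by norm_num)
  rw [airyPath_pi_div_three, max_eq_right hs]
  simp only [pow_succ, pow_zero, one_mul, Complex.mul_re, Complex.mul_im]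
  have : s * s = |s| * |s| := (abs_mul_abs_self s).symm
  linear_combination (-3 * |s| / 8) * s ^ 2 * h3 + (-9 * |s| / 8) * this

theorem continuous_airyPath : Continuous (airyPath (Real.pi / 3)) := by
  have : airyPath (Real.pi / 3) =
      fun s => ((max 1 |s| / 2 : ℝ) : ℂ) + ((Real.sqrt 3 / 2 * s : ℝ) : ℂ) * Complex.I := by
    funext s
    rw [airyPath_pi_div_three, Complex.mk_eq_add_mul_I]
  rw [this]
  fun_prop

theorem measurable_airyPathDeriv (φ : ℝ) : Measurable (airyPathDeriv φ) :=
  Measurable.ite measurableSet_Iic measurable_const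
    (Measurable.ite measurableSet_Iic measurable_const measurable_const)

theorem norm_airyPathDeriv_le (φ s : ℝ) : ‖airyPathDeriv φ s‖ ≤ 1 := by
  unfold airyPathDeriv
  split_ifs
  · rw [norm_neg, ← Complex.ofReal_neg, Complex.norm_exp_ofReal_mul_I]
  · rw [norm_mul, Complex.norm_I, one_mul, Complex.norm_real]
    exact Real.abs_sin_le_one φ
  · rw [Complex.norm_exp_ofReal_mul_I]

theorem hasDerivAt_airyPath (φ : ℝ) {s : ℝ} (h1 : s ≠ -1) (h2 : s ≠ 1) :
    HasDerivAt (airyPath φ) (airyPathDeriv φ s) s := by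
  have hid : HasDerivAt (fun s : ℝ => (s : ℂ)) 1 s := Complex.ofRealCLM.hasDerivAt
  rcases lt_or_gt_of_ne h1 with h | h
  · have hd : airyPathDeriv φ s = -Complex.exp (-(φ : ℂ) * Complex.I) := by
      simp [airyPathDeriv, h.le]
    rw [hd]
    refine HasDerivAt.congr_of_eventuallyEq
      (f := fun s : ℝ => -Complex.exp (-(φ : ℂ) * Complex.I) * (s : ℂ))
      ((hid.const_mul _).congr_deriv (mul_one _)) ?_
    filter_upwards [Iio_mem_nhds h] with x hx
    simp [airyPath, (Set.mem_Iio.1 hx).le]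
  rcases lt_or_gt_of_ne h2 with h' | h'
  · have hd : airyPathDeriv φ s = Complex.I * (Real.sin φ : ℂ) := by
      simp [airyPathDeriv, h.not_ge, h'.le]
    rw [hd]
    refine HasDerivAt.congr_of_eventuallyEq
      (f := fun s : ℝ => (Real.cos φ : ℂ) + Complex.I * (s : ℂ) * (Real.sin φ : ℂ))
      ((((hid.const_mul Complex.I).mul_const (Real.sin φ : ℂ)).const_add _).congr_deriv
        (by rw [mul_one])) ?_
    filter_upwards [Ioo_mem_nhds h h'] with x hx
    simp [airyPath, hx.1.not_ge, hx.2.le]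
  · have hd : airyPathDeriv φ s = Complex.exp ((φ : ℂ) * Complex.I) := by
      simp [airyPathDeriv, h.not_ge, h'.not_ge]
    rw [hd]
    refine HasDerivAt.congr_of_eventuallyEq
      (f := fun s : ℝ => Complex.exp ((φ : ℂ) * Complex.I) * (s : ℂ))
      ((hid.const_mul _).congr_deriv (mul_one _)) ?_
    filter_upwards [Ioi_mem_nhds h'] with x hx
    have hx : 1 < x := hx
    simp [airyPath, hx.not_ge, (show ¬ x ≤ -1 by linarith)]

/-- Measurability of integrands along the contour. -/
theorem aestronglyMeasurable_airyPath {g : ℂ → ℂ} (hg : Continuous g) :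
    AEStronglyMeasurable
      (fun s => g (airyPath (Real.pi / 3) s) * airyPathDeriv (Real.pi / 3) s) volume :=
  (hg.comp continuous_airyPath).aestronglyMeasurable.mul
    (measurable_airyPathDeriv _).aestronglyMeasurable

/-- The fundamental theorem of calculus along the contour. -/
theorem intervalIntegral_airyPath_of_hasDerivAt {P g : ℂ → ℂ} (hP : ∀ t, HasDerivAt P (g t) t)
    (hg : Continuous g) (a b : ℝ) :
    ∫ s in a..b, g (airyPath (Real.pi / 3) s) * airyPathDeriv (Real.pi / 3) s =
      P (airyPath (Real.pi / 3) b) - P (airyPath (Real.pi / 3) a) := by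
  have hPc : Continuous P := continuous_iff_continuousAt.2 fun t => (hP t).continuousAt
  refine MeasureTheory.integral_eq_of_hasDerivAt_off_countable
    (fun s => P (airyPath (Real.pi / 3) s)) _ (s := {-1, 1}) (by simp)
    (hPc.comp continuous_airyPath).continuousOn (fun s hs => ?_) ?_
  · have h := hs.2
    simp only [Set.mem_insert_iff, Set.mem_singleton_iff, not_or] at h
    exact (hP _).comp_of_eq s (hasDerivAt_airyPath _ h.1 h.2) rfl
  · refine ((hg.comp continuous_airyPath).norm.intervalIntegrable a b).mono_fun
      (aestronglyMeasurable_airyPath hg).restrict (Eventually.of_forall fun s => ?_)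
    simp only [norm_mul, norm_norm]
    exact mul_le_of_le_one_right (norm_nonneg _) (norm_airyPathDeriv_le _ _)

/-- An exact form with Gaussian decay of its primitive integrates to zero along the contour. -/
theorem integral_airyPath_eq_zero_of_hasDerivAt {P g : ℂ → ℂ} (hP : ∀ t, HasDerivAt P (g t) t)
    (hg : Continuous g)
    (hi : Integrable fun s => g (airyPath (Real.pi / 3) s) * airyPathDeriv (Real.pi / 3) s)
    {C : ℝ} (hb : ∀ s, ‖P (airyPath (Real.pi / 3) s)‖ ≤ C * Real.exp (-(1 / 16) * s ^ 2)) :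
    ∫ s, g (airyPath (Real.pi / 3) s) * airyPathDeriv (Real.pi / 3) s = 0 := by
  have h1 := intervalIntegral_tendsto_integral hi tendsto_neg_atTop_atBot tendsto_id
  simp only [intervalIntegral_airyPath_of_hasDerivAt hP hg, id] at h1
  have h2 : Tendsto (fun s : ℝ => C * Real.exp (-(1 / 16) * s ^ 2)) atTop (𝓝 0) := by
    rw [← mul_zero C]
    refine (Real.tendsto_exp_atBot.comp ?_).const_mul C
    exact (tendsto_pow_atTop two_ne_zero).const_mul_atTop_of_neg (by norm_num)
  have h3 : Tendsto (fun s => P (airyPath (Real.pi / 3) s) - P (airyPath (Real.pi / 3) (-s)))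
      atTop (𝓝 0) := by
    rw [← sub_zero (0 : ℂ)]
    refine (squeeze_zero_norm hb h2).sub (squeeze_zero_norm (fun s => ?_) h2)
    simpa using hb (-s)
  exact tendsto_nhds_unique h1 h3

theorem re_airyPath_cube_div_three_le (s : ℝ) :
    (airyPath (Real.pi / 3) s ^ 3 / 3).re ≤ 1 - s ^ 2 / 8 := by
  rcases le_total 1 |s| with h | h
  · have h3 : (airyPath (Real.pi / 3) s ^ 3 / 3).re = -|s| ^ 3 / 3 := by
      rw [← re_airyPath_cube h]
      simp
    rw [h3, ← sq_abs s]
    nlinarith [sq_nonneg |s|, mul_nonneg (sq_nonneg |s|) (sub_nonneg.2 h)]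
  · refine (Complex.re_le_norm _).trans ?_
    have h1 : ‖airyPath (Real.pi / 3) s‖ ^ 3 ≤ 1 :=
      pow_le_one₀ (norm_nonneg _) (norm_airyPath_le_one h)
    rw [norm_div, norm_pow]
    norm_num
    nlinarith [(sq_le_one_iff_abs_le_one s).2 h]

/-- Gaussian domination of `e^{A + b}` when `b` grows at most linearly. -/
theorem norm_exp_le_of_re_le {s β : ℝ} {A b : ℂ} (hA : A.re ≤ 1 - s ^ 2 / 8)
    (hb : ‖b‖ ≤ β * (1 + |s|)) :
    ‖Complex.exp (A + b)‖ ≤ Real.exp (1 - s ^ 2 / 8 + β * (1 + |s|)) := by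
  rw [Complex.norm_exp, Complex.add_re]
  exact Real.exp_le_exp.2 (add_le_add hA ((Complex.re_le_norm _).trans hb))

theorem norm_airyPath_exp_le {β : ℝ} {z : ℂ} (hz : ‖z‖ ≤ β) (s : ℝ) :
    ‖Complex.exp (-z * airyPath (Real.pi / 3) s + airyPath (Real.pi / 3) s ^ 3 / 3)‖ ≤
      Real.exp (1 - s ^ 2 / 8 + β * (1 + |s|)) := by
  rw [add_comm]
  refine norm_exp_le_of_re_le (re_airyPath_cube_div_three_le s) ?_
  rw [norm_mul, norm_neg]
  exact mul_le_mul hz (norm_airyPath_le s) (norm_nonneg _) ((norm_nonneg _).trans hz)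

theorem norm_airyPath_pow_mul_exp_le (k : ℕ) {β : ℝ} {z : ℂ} (hz : ‖z‖ ≤ β) (s : ℝ) :
    ‖airyPath (Real.pi / 3) s ^ k *
        Complex.exp (-z * airyPath (Real.pi / 3) s + airyPath (Real.pi / 3) s ^ 3 / 3)‖ ≤
      (1 + |s|) ^ k * Real.exp (1 - s ^ 2 / 8 + β * (1 + |s|)) := by
  rw [norm_mul, norm_pow]
  gcongr
  · exact norm_airyPath_le s
  · exact norm_airyPath_exp_le hz s

/-- The `k`-th moment `∫ t^k e^{-zt + t³/3} dt` along the Airy contour. -/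
noncomputable def airyMoment (k : ℕ) (z : ℂ) : ℂ :=
  ∫ s : ℝ, airyPath (Real.pi / 3) s ^ k *
    Complex.exp (-z * airyPath (Real.pi / 3) s + airyPath (Real.pi / 3) s ^ 3 / 3) *
      airyPathDeriv (Real.pi / 3) s

theorem norm_mul_airyPathDeriv_le (a : ℂ) (φ s : ℝ) : ‖a * airyPathDeriv φ s‖ ≤ ‖a‖ := by
  rw [norm_mul]
  exact mul_le_of_le_one_right (norm_nonneg _) (norm_airyPathDeriv_le _ _)

theorem integrable_airyMoment (k : ℕ) (z : ℂ) :
    Integrable fun s : ℝ => airyPath (Real.pi / 3) s ^ k *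
      Complex.exp (-z * airyPath (Real.pi / 3) s + airyPath (Real.pi / 3) s ^ 3 / 3) *
        airyPathDeriv (Real.pi / 3) s :=
  (integrable_one_add_abs_pow_mul_exp k 1 ‖z‖).mono'
    (aestronglyMeasurable_airyPath (g := fun t => t ^ k * Complex.exp (-z * t + t ^ 3 / 3))
      (by fun_prop))
    (Eventually.of_forall fun s => (norm_mul_airyPathDeriv_le _ _ s).trans
      (norm_airyPath_pow_mul_exp_le k le_rfl s))

theorem airyAi_eq_airyMoment (z : ℂ) :
    airyAi z = 1 / (2 * (Real.pi : ℂ) * Complex.I) * airyMoment 0 z := by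
  simp [airyAi, airyMoment]

theorem hasDerivAt_airyMoment_zero (z : ℂ) : HasDerivAt (airyMoment 0) (-airyMoment 1 z) z := by
  have h := hasDerivAt_integral_of_dominated_loc_of_deriv_le (μ := volume) (x₀ := z)
    (s := Metric.ball z 1)
    (F := fun z s => airyPath (Real.pi / 3) s ^ 0 *
      Complex.exp (-z * airyPath (Real.pi / 3) s + airyPath (Real.pi / 3) s ^ 3 / 3) *
        airyPathDeriv (Real.pi / 3) s)
    (F' := fun z s => -(airyPath (Real.pi / 3) s ^ 1 *
      Complex.exp (-z * airyPath (Real.pi / 3) s + airyPath (Real.pi / 3) s ^ 3 / 3) *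
        airyPathDeriv (Real.pi / 3) s))
    (bound := fun s => (1 + |s|) ^ 1 * Real.exp (1 - s ^ 2 / 8 + (‖z‖ + 1) * (1 + |s|)))
    (Metric.ball_mem_nhds z one_pos)
    (Eventually.of_forall fun z => (integrable_airyMoment 0 z).aestronglyMeasurable)
    (integrable_airyMoment 0 z) (integrable_airyMoment 1 z).neg.aestronglyMeasurable
    (Eventually.of_forall fun s y hy => ?_)
    (integrable_one_add_abs_pow_mul_exp 1 1 (‖z‖ + 1))
    (Eventually.of_forall fun s y hy => ?_)
  · refine h.2.congr_deriv ?_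
    rw [integral_neg]
    rfl
  · rw [norm_neg]
    refine (norm_mul_airyPathDeriv_le _ _ s).trans (norm_airyPath_pow_mul_exp_le 1 ?_ s)
    have h1 := norm_sub_norm_le y z
    rw [Metric.mem_ball, dist_eq_norm] at hy
    linarith
  · have h1 : HasDerivAt
        (fun y : ℂ => -y * airyPath (Real.pi / 3) s + airyPath (Real.pi / 3) s ^ 3 / 3)
        (-airyPath (Real.pi / 3) s) y := by
      simpa using ((hasDerivAt_id y).neg.mul_const (airyPath (Real.pi / 3) s)).add_const
        (airyPath (Real.pi / 3) s ^ 3 / 3)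
    refine ((h1.cexp.const_mul _).mul_const _).congr_deriv ?_
    ring

theorem airyAi'_eq_airyMoment (z : ℂ) :
    airyAi' z = -(1 / (2 * (Real.pi : ℂ) * Complex.I) * airyMoment 1 z) := by
  have h : airyAi = fun z => 1 / (2 * (Real.pi : ℂ) * Complex.I) * airyMoment 0 z :=
    funext airyAi_eq_airyMoment
  rw [airyAi', h, ((hasDerivAt_airyMoment_zero z).const_mul _).deriv, mul_neg]

/-- Integration by parts: `∫ d(t^k e^{-zt + t³/3}) = 0`. -/
theorem airyMoment_add_two (k : ℕ) (z : ℂ) :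
    k * airyMoment (k - 1) z + airyMoment (k + 2) z - z * airyMoment k z = 0 := by
  obtain ⟨C, hC⟩ := exists_one_add_abs_pow_mul_exp_le k 1 ‖z‖
  have hi := (((integrable_airyMoment (k - 1) z).const_mul (k : ℂ)).add
    (integrable_airyMoment (k + 2) z)).sub ((integrable_airyMoment k z).const_mul z)
  have h := integral_airyPath_eq_zero_of_hasDerivAt
    (P := fun t => t ^ k * Complex.exp (-z * t + t ^ 3 / 3))
    (g := fun t => k * (t ^ (k - 1) * Complex.exp (-z * t + t ^ 3 / 3)) +
      t ^ (k + 2) * Complex.exp (-z * t + t ^ 3 / 3) -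
      z * (t ^ k * Complex.exp (-z * t + t ^ 3 / 3)))
    (fun t => ?_) (by fun_prop) ?_
    (fun s => (norm_airyPath_pow_mul_exp_le k le_rfl s).trans (hC s))
  · rw [← h]
    unfold airyMoment
    rw [← integral_const_mul, ← integral_const_mul, ← integral_add, ← integral_sub]
    · refine integral_congr_ae (Eventually.of_forall fun s => ?_)
      simp only
      ring
    · exact ((integrable_airyMoment (k - 1) z).const_mul (k : ℂ)).add
        (integrable_airyMoment (k + 2) z)
    · exact (integrable_airyMoment k z).const_mul z
    · exact (integrable_airyMoment (k - 1) z).const_mul (k : ℂ)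
    · exact integrable_airyMoment (k + 2) z
  · have h1 : HasDerivAt (fun t : ℂ => -z * t + t ^ 3 / 3) (-z + t ^ 2) t := by
      refine (((hasDerivAt_id t).const_mul (-z)).add
        ((hasDerivAt_pow 3 t).div_const 3)).congr_deriv ?_
      norm_num
    refine ((hasDerivAt_pow k t).mul h1.cexp).congr_deriv ?_
    ring
  · refine hi.congr (Eventually.of_forall fun s => ?_)
    simp only [Pi.add_apply, Pi.sub_apply]
    ring

theorem airyMoment_two (z : ℂ) : airyMoment 2 z = z * airyMoment 0 z := by
  have h := airyMoment_add_two 0 z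
  simp only [Nat.cast_zero, zero_mul, zero_add] at h
  linear_combination h

theorem airyMoment_four (z : ℂ) :
    airyMoment 4 z = z ^ 2 * airyMoment 0 z - 2 * airyMoment 1 z := by
  have h := airyMoment_add_two 2 z
  norm_num at h
  linear_combination h + z * airyMoment_two z

/-- A primitive of a function with Gaussian decay changes little along the vertical segment
that joins the real axis to the rescaled contour. -/
theorem norm_sub_primitive_le {f P : ℂ → ℂ} (hP : ∀ x, HasDerivAt P (f x) x)
    {κ C δ : ℝ} (hκ : 0 < κ) (hκ2 : κ ≤ 2) (hδ : 0 < δ)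
    (hb : ∀ x : ℂ, x.im ≤ 1 → 3 * x.im ^ 2 ≤ x.re ^ 2 + 3 → ‖f x‖ ≤ C * Real.exp (-δ * x.re ^ 2))
    {s : ℝ} (hs : 2 / κ ≤ |s|) :
    ‖P (κ * (Real.sqrt 3 / 2 * s) : ℝ) -
        P (Complex.I * (1 - κ * airyPath (Real.pi / 3) s))‖ ≤
      C / δ * |κ * (Real.sqrt 3 / 2 * s)|⁻¹ := by
  have hC : 0 ≤ C := by simpa using (norm_nonneg _).trans (hb 0 (by simp) (by simp))
  have h3 := Real.sq_sqrt (show (0 : ℝ) ≤ 3 by norm_num)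
  have h30 : 1 ≤ Real.sqrt 3 := by rw [Real.one_le_sqrt]; norm_num
  have hs2 : 2 ≤ κ * |s| := by rwa [div_le_iff₀ hκ, mul_comm] at hs
  have hs1 : 1 ≤ |s| := by nlinarith
  set T : ℝ := κ * (Real.sqrt 3 / 2 * s) with hT
  have hTabs : |T| = κ * (Real.sqrt 3 / 2 * |s|) := by
    rw [hT, abs_mul, abs_mul, abs_of_pos hκ, abs_of_pos (by positivity)]
  have hT0 : 0 < |T| := by rw [hTabs]; positivity
  have hTs : κ * |s| / 2 ≤ |T| := by rw [hTabs]; nlinarith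
  set x : ℂ := Complex.I * (1 - κ * airyPath (Real.pi / 3) s) with hx
  have hxre : x.re = T := by simp [hx, hT, im_airyPath]
  have hxim : x.im = 1 - κ * |s| / 2 := by
    simp [hx, re_airyPath, max_eq_right hs1]
    ring
  have hconv : Convex ℝ (({T} : Set ℝ) ×ℂ Set.Icc (1 - κ * |s| / 2) 1) :=
    ((convex_singleton T).linear_preimage Complex.reLm).inter
      ((convex_Icc _ _).linear_preimage Complex.imLm)
  have hbound : ∀ y ∈ ({T} : Set ℝ) ×ℂ Set.Icc (1 - κ * |s| / 2) 1,
      ‖f y‖ ≤ C * Real.exp (-δ * T ^ 2) := by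
    intro y hy
    rw [Complex.mem_reProdIm, Set.mem_singleton_iff] at hy
    obtain ⟨hy1, hy2, hy3⟩ := hy
    rw [← hy1]
    refine hb y hy3 ?_
    have hT2 : y.re ^ 2 = 3 * (κ * |s| / 2) ^ 2 := by
      rw [hy1, ← sq_abs, hTabs]
      linear_combination κ ^ 2 * |s| ^ 2 / 4 * h3
    rw [hT2]
    nlinarith
  have h := Convex.norm_image_sub_le_of_norm_hasDerivWithin_le
    (fun y _ => (hP y).hasDerivWithinAt) hbound hconv (x := x) (y := (T : ℂ))
    (by rw [Complex.mem_reProdIm, hxre, hxim]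
        exact ⟨rfl, le_rfl, by linarith⟩)
    (by rw [Complex.mem_reProdIm]
        simp only [Complex.ofReal_re, Complex.ofReal_im]
        exact ⟨rfl, by linarith, by norm_num⟩)
  refine h.trans ?_
  have hlen : ‖(T : ℂ) - x‖ ≤ |T| := by
    have : (T : ℂ) - x = ((κ * |s| / 2 - 1 : ℝ) : ℂ) * Complex.I := by
      apply Complex.ext
      · simp [hxre]
      · simp [hxim]
    rw [this, norm_mul, Complex.norm_I, mul_one, Complex.norm_real, Real.norm_eq_abs, abs_of_nonneg]
    · linarith
    · linarith
  have hexp : Real.exp (-δ * T ^ 2) * |T| ≤ δ⁻¹ * |T|⁻¹ := by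
    have h1 : δ * T ^ 2 ≤ Real.exp (δ * T ^ 2) := by
      linarith [Real.add_one_le_exp (δ * T ^ 2)]
    rw [neg_mul, Real.exp_neg, ← sq_abs]
    rw [← sq_abs] at h1
    calc (Real.exp (δ * |T| ^ 2))⁻¹ * |T| ≤ (δ * |T| ^ 2)⁻¹ * |T| := by gcongr
      _ = δ⁻¹ * |T|⁻¹ := by field_simp
  calc C * Real.exp (-δ * T ^ 2) * ‖(T : ℂ) - x‖
      ≤ C * Real.exp (-δ * T ^ 2) * |T| := by gcongr
    _ = C * (Real.exp (-δ * T ^ 2) * |T|) := by ring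
    _ ≤ C * (δ⁻¹ * |T|⁻¹) := by gcongr
    _ = C / δ * |T|⁻¹ := by ring

/-- Deformation of the real line to the rescaled and rotated Airy contour. -/
theorem integral_real_eq_integral_airyPath {f : ℂ → ℂ} (hf : Differentiable ℂ f)
    {κ C δ : ℝ} (hκ : 0 < κ) (hκ2 : κ ≤ 2) (hδ : 0 < δ)
    (hb : ∀ x : ℂ, x.im ≤ 1 → 3 * x.im ^ 2 ≤ x.re ^ 2 + 3 →
      ‖f x‖ ≤ C * Real.exp (-δ * x.re ^ 2)) :
    ∫ x : ℝ, f x = ∫ s : ℝ, f (Complex.I * (1 - κ * airyPath (Real.pi / 3) s)) *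
      (-Complex.I * κ) * airyPathDeriv (Real.pi / 3) s := by
  obtain ⟨P, hP⟩ := hf.isExactOn_univ
  replace hP : ∀ x, HasDerivAt P (f x) x := fun x => hP x (Set.mem_univ x)
  have hfc := hf.continuous
  have h3 := Real.sq_sqrt (show (0 : ℝ) ≤ 3 by norm_num)
  have h30 : 0 < Real.sqrt 3 := by positivity
  have hi1 : Integrable fun x : ℝ => f x := by
    refine ((integrable_exp_neg_mul_sq hδ).const_mul C).mono'
      (hfc.comp Complex.continuous_ofReal).aestronglyMeasurable (Eventually.of_forall fun x => ?_)
    have hx := hb x (by simp) (by simp; positivity)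
    simpa using hx
  have hi2 : Integrable fun s : ℝ => f (Complex.I * (1 - κ * airyPath (Real.pi / 3) s)) *
      (-Complex.I * κ) * airyPathDeriv (Real.pi / 3) s := by
    refine ((integrable_exp_neg_mul_sq (b := δ * (κ ^ 2 * (3 / 4))) (by positivity)).const_mul
      (C * κ)).mono' (aestronglyMeasurable_airyPath
        (g := fun t => f (Complex.I * (1 - κ * t)) * (-Complex.I * κ)) (by fun_prop))
      (Eventually.of_forall fun s => ?_)
    refine (norm_mul_airyPathDeriv_le _ _ s).trans ?_
    rw [norm_mul]
    have hre : (Complex.I * (1 - κ * airyPath (Real.pi / 3) s)).re = κ * (Real.sqrt 3 / 2 * s) := by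
      simp [im_airyPath]
    have him : (Complex.I * (1 - κ * airyPath (Real.pi / 3) s)).im = 1 - κ * max 1 |s| / 2 := by
      simp [re_airyPath]
      ring
    have hre2 : (κ * (Real.sqrt 3 / 2 * s)) ^ 2 = κ ^ 2 * (3 / 4) * s ^ 2 := by
      linear_combination κ ^ 2 * s ^ 2 / 4 * h3
    have hx := hb (Complex.I * (1 - κ * airyPath (Real.pi / 3) s))
      (by rw [him]
          have : 0 ≤ κ * max 1 |s| := by positivity
          linarith)
      (by rw [him, hre, hre2]
          rcases le_total 1 |s| with h | h
          · rw [max_eq_right h, ← sq_abs s]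
            nlinarith [mul_pos hκ (zero_lt_one.trans_le h)]
          · rw [max_eq_left h]
            have : 0 ≤ κ ^ 2 * (3 / 4) * s ^ 2 := by positivity
            nlinarith)
    rw [hre, hre2] at hx
    have hn : ‖-Complex.I * (κ : ℂ)‖ = κ := by simp [abs_of_pos hκ]
    rw [hn]
    calc _ ≤ C * Real.exp (-δ * (κ ^ 2 * (3 / 4) * s ^ 2)) * κ := by gcongr
      _ = _ := by
        rw [mul_right_comm]
        congr 2
        ring
  have hT : Tendsto (fun R : ℝ => κ * (Real.sqrt 3 / 2 * R)) atTop atTop :=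
    (tendsto_id.const_mul_atTop (by positivity)).const_mul_atTop hκ
  have h1 := intervalIntegral_tendsto_integral hi1 (tendsto_neg_atTop_atBot.comp hT) hT
  have h2 := intervalIntegral_tendsto_integral hi2 tendsto_neg_atTop_atBot tendsto_id
  have e1 : ∀ T : ℝ, ∫ x in (-T)..T, f (x : ℂ) = P (T : ℂ) - P ((-T : ℝ) : ℂ) := fun T =>
    intervalIntegral.integral_eq_sub_of_hasDerivAt (fun x _ => (hP x).comp_ofReal)
      (Continuous.intervalIntegrable (by fun_prop) _ _)
  have e2 := intervalIntegral_airyPath_of_hasDerivAt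
    (P := fun t => P (Complex.I * (1 - κ * t)))
    (g := fun t => f (Complex.I * (1 - κ * t)) * (-Complex.I * κ))
    (fun t => by
      have hl : HasDerivAt (fun t : ℂ => Complex.I * (1 - κ * t)) (-Complex.I * κ) t := by
        refine ((((hasDerivAt_id t).const_mul (κ : ℂ)).const_sub 1).const_mul
          Complex.I).congr_deriv ?_
        ring
      exact (hP _).comp_of_eq t hl rfl)
    (by fun_prop)
  simp only [Function.comp_def, e1] at h1
  simp only [e2, id] at h2
  have hlim : Tendsto (fun R : ℝ => C / δ * |κ * (Real.sqrt 3 / 2 * R)|⁻¹) atTop (𝓝 0) := by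
    rw [← mul_zero (C / δ)]
    exact (tendsto_inv_atTop_zero.comp (tendsto_abs_atTop_atTop.comp hT)).const_mul _
  have hd1 : Tendsto (fun R : ℝ => P (κ * (Real.sqrt 3 / 2 * R) : ℝ) -
      P (Complex.I * (1 - κ * airyPath (Real.pi / 3) R))) atTop (𝓝 0) := by
    refine squeeze_zero_norm' ?_ hlim
    filter_upwards [eventually_ge_atTop (2 / κ)] with R hR
    exact norm_sub_primitive_le hP hκ hκ2 hδ hb (hR.trans (le_abs_self R))
  have hd2 : Tendsto (fun R : ℝ => P (-(κ * (Real.sqrt 3 / 2 * R)) : ℝ) -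
      P (Complex.I * (1 - κ * airyPath (Real.pi / 3) (-R)))) atTop (𝓝 0) := by
    refine squeeze_zero_norm' ?_ hlim
    filter_upwards [eventually_ge_atTop (2 / κ)] with R hR
    have := norm_sub_primitive_le hP hκ hκ2 hδ hb (s := -R)
      (by rw [abs_neg]; exact hR.trans (le_abs_self R))
    simpa only [mul_neg, abs_neg] using this
  have h4 := (hd1.sub hd2).add h2
  rw [sub_zero, zero_add] at h4
  refine tendsto_nhds_unique h1 (h4.congr fun R => ?_)
  ring

/-- The rescaled exponent at the double saddle point, with `ζ = -cεt`. -/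
noncomputable def saddleExponent (c : ℝ) (τ : ℂ) (ε : ℝ) (t : ℂ) : ℂ :=
  (1 + -(c * ε * t) + (-(c * ε * t)) ^ 2 / 2 - Complex.exp (-(c * ε * t))) / ε ^ 3 +
    τ * (Complex.exp (-(c * ε * t)) - 1) / ε

/-- The first-order coefficient in `ε` of the saddle-point exponent. -/
noncomputable def saddleCorrection (c : ℝ) (τ t : ℂ) : ℂ :=
  -(c / 12) * t ^ 4 + τ * c ^ 2 / 2 * t ^ 2

theorem norm_exp_sub_exp_le {A B : ℂ} {M : ℝ} (hA : ‖Complex.exp A‖ ≤ M)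
    (hB : ‖Complex.exp B‖ ≤ M) : ‖Complex.exp A - Complex.exp B‖ ≤ M * ‖A - B‖ := by
  have h := Complex.norm_exp_sub_sum_le_max_mul (A - B) 1
  simp only [Finset.sum_range_one, pow_zero, Nat.factorial_zero, Nat.cast_one, div_one, pow_one,
    Nat.factorial_one] at h
  have e : Complex.exp A - Complex.exp B = Complex.exp B * (Complex.exp (A - B) - 1) := by
    rw [mul_sub, ← Complex.exp_add]
    ring_nf
  have hM : ‖Complex.exp B‖ * max 1 (Real.exp (A - B).re) ≤ M := by
    rw [mul_max_of_nonneg _ _ (norm_nonneg _), ← Complex.norm_exp, ← norm_mul, ← Complex.exp_add]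
    simpa using ⟨hB, hA⟩
  rw [e, norm_mul]
  calc _ ≤ ‖Complex.exp B‖ * (max 1 (Real.exp (A - B).re) * ‖A - B‖) := by gcongr
    _ = ‖Complex.exp B‖ * max 1 (Real.exp (A - B).re) * ‖A - B‖ := by ring
    _ ≤ _ := by gcongr

theorem norm_exp_sub_exp_mul_one_add_le {A B h : ℂ} {M : ℝ} (hA : ‖Complex.exp A‖ ≤ M)
    (hB : ‖Complex.exp B‖ ≤ M) :
    ‖Complex.exp A - Complex.exp B * (1 + h)‖ ≤ M * (‖A - B‖ ^ 2 + ‖A - B - h‖) := by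
  have h2 := Complex.norm_exp_sub_sum_le_max_mul (A - B) 2
  simp only [Finset.sum_range_succ, Finset.sum_range_zero, pow_zero, Nat.factorial_zero,
    Nat.cast_one, div_one, pow_one, Nat.factorial_one, zero_add, Nat.factorial_two,
    Nat.cast_ofNat] at h2
  have e : Complex.exp A - Complex.exp B * (1 + h) =
      Complex.exp B * (Complex.exp (A - B) - (1 + (A - B))) + Complex.exp B * (A - B - h) := by
    rw [mul_sub, ← Complex.exp_add]
    ring_nf
  have hM : ‖Complex.exp B‖ * max 1 (Real.exp (A - B).re) ≤ M := by
    rw [mul_max_of_nonneg _ _ (norm_nonneg _), ← Complex.norm_exp, ← norm_mul, ← Complex.exp_add]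
    simpa using ⟨hB, hA⟩
  rw [e, mul_add]
  refine (norm_add_le _ _).trans (add_le_add ?_ ?_)
  · rw [norm_mul]
    calc _ ≤ ‖Complex.exp B‖ * (max 1 (Real.exp (A - B).re) * (‖A - B‖ ^ 2 / 2)) := by gcongr
      _ = ‖Complex.exp B‖ * max 1 (Real.exp (A - B).re) * (‖A - B‖ ^ 2 / 2) := by ring
      _ ≤ M * (‖A - B‖ ^ 2 / 2) := by gcongr
      _ ≤ _ := by
        have : 0 ≤ M := (norm_nonneg _).trans hA
        gcongr
        linarith [sq_nonneg ‖A - B‖]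
  · rw [norm_mul]
    gcongr

section Saddle

variable {c ε m : ℝ} {τ t : ℂ}

theorem norm_neg_mul_mul (hc0 : 0 ≤ c) (hε : 0 ≤ ε) : ‖-((c : ℂ) * ε * t)‖ = c * ε * ‖t‖ := by
  rw [norm_neg, norm_mul, norm_mul, Complex.norm_real, Complex.norm_real,
    Real.norm_of_nonneg hc0, Real.norm_of_nonneg hε]

theorem re_neg_mul_mul_nonpos (hc0 : 0 ≤ c) (hε : 0 ≤ ε) (ht : 0 ≤ t.re) :
    (-((c : ℂ) * ε * t)).re ≤ 0 := by
  have : 0 ≤ c * ε * t.re := by positivity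
  rw [← Complex.ofReal_mul, Complex.neg_re, Complex.re_ofReal_mul]
  linarith

/-- Taylor's estimate for `e^{-cεt}` to order `n`. -/
theorem norm_exp_neg_sub_sum_le (hc0 : 0 ≤ c) (hε : 0 ≤ ε) (ht : 0 ≤ t.re) (htm : ‖t‖ ≤ m)
    (n : ℕ) :
    ‖Complex.exp (-((c : ℂ) * ε * t)) -
        ∑ k ∈ Finset.range n, (-((c : ℂ) * ε * t)) ^ k / (k.factorial : ℂ)‖ ≤
      c ^ n / n.factorial * ε ^ n * m ^ n := by
  refine (Complex.norm_exp_sub_sum_le_of_re_nonpos (re_neg_mul_mul_nonpos hc0 hε ht) n).trans ?_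
  rw [norm_neg_mul_mul hc0 hε, mul_pow, mul_pow]
  have : ‖t‖ ^ n ≤ m ^ n := by gcongr
  calc c ^ n * ε ^ n * ‖t‖ ^ n / n.factorial = c ^ n / n.factorial * ε ^ n * ‖t‖ ^ n := by ring
    _ ≤ _ := by gcongr

theorem norm_saddleExponent_sub_le (hc0 : 0 ≤ c) (hc : c ≤ 2) (hc3 : c ^ 3 = 2)
    (hε : 0 < ε) (ht : 0 ≤ t.re) (htm : ‖t‖ ≤ m) (hm : 1 ≤ m) :
    ‖saddleExponent c τ ε t - (-(c * τ) * t + t ^ 3 / 3)‖ ≤ (1 + 2 * ‖τ‖) * ε * m ^ 4 := by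
  have hεc : (ε : ℂ) ≠ 0 := by exact_mod_cast hε.ne'
  have hc3' : (c : ℂ) ^ 3 = 2 := by exact_mod_cast hc3
  have h4 := norm_exp_neg_sub_sum_le hc0 hε.le ht htm 4
  have h2 := norm_exp_neg_sub_sum_le hc0 hε.le ht htm 2
  set R4 := Complex.exp (-((c : ℂ) * ε * t)) -
    ∑ k ∈ Finset.range 4, (-((c : ℂ) * ε * t)) ^ k / (k.factorial : ℂ) with hR4
  set R2 := Complex.exp (-((c : ℂ) * ε * t)) -
    ∑ k ∈ Finset.range 2, (-((c : ℂ) * ε * t)) ^ k / (k.factorial : ℂ) with hR2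
  have e : saddleExponent c τ ε t - (-(c * τ) * t + t ^ 3 / 3) =
      -R4 / (ε : ℂ) ^ 3 + τ * R2 / ε := by
    rw [hR4, hR2]
    simp only [saddleExponent, Finset.sum_range_succ, Finset.sum_range_zero, Nat.factorial]
    push_cast
    field_simp
    linear_combination 6 * ε ^ 3 * t ^ 3 * hc3'
  rw [e]
  refine (norm_add_le _ _).trans ?_
  rw [norm_div, norm_div, norm_neg, norm_mul, norm_pow, Complex.norm_real,
    Real.norm_of_nonneg hε.le]
  have hm2 : m ^ 2 ≤ m ^ 4 := pow_le_pow_right₀ hm (by norm_num)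
  have hm0 : 0 < m := by linarith
  have b4 : ‖R4‖ / ε ^ 3 ≤ ε * m ^ 4 := by
    rw [div_le_iff₀ (by positivity)]
    refine h4.trans ?_
    have : c ^ 4 / (Nat.factorial 4 : ℕ) ≤ 1 := by
      have : c ^ 4 ≤ 2 ^ 4 := by gcongr
      norm_num [Nat.factorial]
      linarith
    calc _ ≤ 1 * ε ^ 4 * m ^ 4 := by gcongr
      _ = _ := by ring
  have b2 : ‖τ‖ * ‖R2‖ / ε ≤ 2 * ‖τ‖ * ε * m ^ 4 := by
    rw [div_le_iff₀ hε]
    have : c ^ 2 / (Nat.factorial 2 : ℕ) ≤ 2 := by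
      have : c ^ 2 ≤ 2 ^ 2 := by gcongr
      norm_num [Nat.factorial]
      linarith
    calc _ ≤ ‖τ‖ * (2 * ε ^ 2 * m ^ 4) := by
          refine mul_le_mul_of_nonneg_left (h2.trans ?_) (norm_nonneg _)
          gcongr
      _ = _ := by ring
  linarith

theorem norm_saddleExponent_sub_sub_le (hc0 : 0 ≤ c) (hc : c ≤ 2) (hc3 : c ^ 3 = 2)
    (hε : 0 < ε) (ht : 0 ≤ t.re) (htm : ‖t‖ ≤ m) (hm : 1 ≤ m) :
    ‖saddleExponent c τ ε t - (-(c * τ) * t + t ^ 3 / 3) - ε * saddleCorrection c τ t‖ ≤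
      (1 + 2 * ‖τ‖) * ε ^ 2 * m ^ 5 := by
  have hεc : (ε : ℂ) ≠ 0 := by exact_mod_cast hε.ne'
  have hc3' : (c : ℂ) ^ 3 = 2 := by exact_mod_cast hc3
  have h5 := norm_exp_neg_sub_sum_le hc0 hε.le ht htm 5
  have h3 := norm_exp_neg_sub_sum_le hc0 hε.le ht htm 3
  set R5 := Complex.exp (-((c : ℂ) * ε * t)) -
    ∑ k ∈ Finset.range 5, (-((c : ℂ) * ε * t)) ^ k / (k.factorial : ℂ) with hR5
  set R3 := Complex.exp (-((c : ℂ) * ε * t)) -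
    ∑ k ∈ Finset.range 3, (-((c : ℂ) * ε * t)) ^ k / (k.factorial : ℂ) with hR3
  have e : saddleExponent c τ ε t - (-(c * τ) * t + t ^ 3 / 3) - ε * saddleCorrection c τ t =
      -R5 / (ε : ℂ) ^ 3 + τ * R3 / ε := by
    rw [hR5, hR3]
    simp only [saddleExponent, saddleCorrection, Finset.sum_range_succ, Finset.sum_range_zero,
      Nat.factorial]
    push_cast
    field_simp
    linear_combination (1728 * ε ^ 3 * t ^ 3 - 432 * c * ε ^ 4 * t ^ 4) * hc3'
  rw [e]
  refine (norm_add_le _ _).trans ?_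
  rw [norm_div, norm_div, norm_neg, norm_mul, norm_pow, Complex.norm_real,
    Real.norm_of_nonneg hε.le]
  have hm3 : m ^ 3 ≤ m ^ 5 := pow_le_pow_right₀ hm (by norm_num)
  have hm0 : 0 < m := by linarith
  have b5 : ‖R5‖ / ε ^ 3 ≤ ε ^ 2 * m ^ 5 := by
    rw [div_le_iff₀ (by positivity)]
    refine h5.trans ?_
    have : c ^ 5 / (Nat.factorial 5 : ℕ) ≤ 1 := by
      have : c ^ 5 ≤ 2 ^ 5 := by gcongr
      norm_num [Nat.factorial]
      linarith
    calc _ ≤ 1 * ε ^ 5 * m ^ 5 := by gcongr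
      _ = _ := by ring
  have b3 : ‖τ‖ * ‖R3‖ / ε ≤ 2 * ‖τ‖ * ε ^ 2 * m ^ 5 := by
    rw [div_le_iff₀ hε]
    have : c ^ 3 / (Nat.factorial 3 : ℕ) ≤ 2 := by
      rw [hc3]
      norm_num [Nat.factorial]
    calc _ ≤ ‖τ‖ * (2 * ε ^ 3 * m ^ 5) := by
          refine mul_le_mul_of_nonneg_left (h3.trans ?_) (norm_nonneg _)
          gcongr
      _ = _ := by ring
  linarith

/-- Uniform decay of the leading part of the exponent along the contour. -/
theorem re_saddle_le (hc1 : 1 ≤ c) (hc3 : c ^ 3 = 2) (hε : 0 < ε) (hε1 : ε ≤ 1) (s : ℝ) :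
    ((1 + -(c * ε * airyPath (Real.pi / 3) s) + (-(c * ε * airyPath (Real.pi / 3) s)) ^ 2 / 2 -
      Complex.exp (-(c * ε * airyPath (Real.pi / 3) s))) / (ε : ℂ) ^ 3).re ≤ 1 - s ^ 2 / 8 := by
  have hc0 : 0 ≤ c := by linarith
  have ht : 0 ≤ (airyPath (Real.pi / 3) s).re := by rw [re_airyPath]; positivity
  set t := airyPath (Real.pi / 3) s with htdef
  set ζ : ℂ := -(c * ε * t) with hζ
  have hζ0 : ζ.re ≤ 0 := re_neg_mul_mul_nonpos hc0 hε.le ht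
  have hn : ‖ζ‖ = c * ε * ‖t‖ := norm_neg_mul_mul hc0 hε.le
  rw [← Complex.ofReal_pow, Complex.div_ofReal_re, div_le_iff₀ (by positivity)]
  rcases le_total 1 |s| with h | h
  · have htn : ‖t‖ = |s| := norm_airyPath_of_one_le_abs h
    have hs2 : |s| ^ 2 ≤ |s| ^ 3 := pow_le_pow_right₀ h (by norm_num)
    rw [htn] at hn
    set q := c * ε * |s| with hq
    have hq0 : 0 ≤ q := by positivity
    have hζre : ζ.re = -q / 2 := by
      rw [hζ, ← Complex.ofReal_mul, Complex.neg_re, Complex.re_ofReal_mul, htdef, re_airyPath,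
        max_eq_right h, hq]
      ring
    have hζim : ζ.im = -(c * ε * (Real.sqrt 3 / 2 * s)) := by
      rw [hζ, ← Complex.ofReal_mul, Complex.neg_im, Complex.im_ofReal_mul, htdef, im_airyPath]
    have h3 := Real.sq_sqrt (show (0 : ℝ) ≤ 3 by norm_num)
    have hζ2 : (ζ ^ 2).re = -q ^ 2 / 2 := by
      rw [pow_two, Complex.mul_re, hζre, hζim, hq]
      linear_combination (-(c * ε) ^ 2 * s ^ 2 / 4) * h3 + (c * ε) ^ 2 * 3 / 4 * sq_abs s
    have hq3 : q ^ 3 = 2 * ε ^ 3 * |s| ^ 3 := by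
      rw [hq]; linear_combination ε ^ 3 * |s| ^ 3 * hc3
    have hζ3 : (ζ ^ 3).re = q ^ 3 := by
      have : ζ ^ 3 = ((-(c * ε) ^ 3 : ℝ) : ℂ) * t ^ 3 := by
        rw [hζ]; push_cast; ring
      rw [this, Complex.re_ofReal_mul, htdef, re_airyPath_cube h, hq]
      ring
    rcases le_total q 2 with hq2 | hq2
    · have hT := Complex.norm_exp_sub_sum_le_of_re_nonpos hζ0 4
      have hT' := (Complex.abs_re_le_norm _).trans hT
      simp only [Finset.sum_range_succ, Finset.sum_range_zero, Nat.factorial] at hT'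
      norm_num [hn] at hT'
      have hsum : (1 + ζ + ζ ^ 2 / 2 - Complex.exp ζ).re ≤ -q ^ 3 / 12 := by
        have h6 : (ζ ^ 2 / 2).re = (ζ ^ 2).re / 2 := by simp
        have h7 : q ^ 4 ≤ 2 * q ^ 3 := by
          nlinarith [pow_nonneg hq0 3]
        have h8 := (abs_le.1 hT').1
        rw [hζ3] at h8
        simp only [Complex.add_re, Complex.sub_re, Complex.one_re, h6]
        linarith
      refine hsum.trans ?_
      rw [hq3, ← sq_abs s]
      nlinarith [pow_pos hε 3]
    · have hexp : Real.exp (-q / 2) ≤ 1 / 2 := by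
        have h1 : 2 ≤ Real.exp (q / 2) := by linarith [Real.add_one_le_exp (q / 2)]
        rw [neg_div, Real.exp_neg, one_div]
        exact inv_anti₀ (by norm_num) h1
      have hsum : (1 + ζ + ζ ^ 2 / 2 - Complex.exp ζ).re ≤ -q ^ 2 / 8 := by
        have h6 : (ζ ^ 2 / 2).re = -q ^ 2 / 4 := by
          have : (ζ ^ 2 / 2).re = (ζ ^ 2).re / 2 := by simp
          rw [this, hζ2]; ring
        have h8 : -Real.exp (-q / 2) ≤ (Complex.exp ζ).re := by
          rw [← hζre, ← Complex.norm_exp]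
          exact (abs_le.1 (Complex.abs_re_le_norm _)).1
        simp only [Complex.add_re, Complex.sub_re, Complex.one_re, h6, hζre]
        nlinarith
      refine hsum.trans ?_
      have h9 : ε ^ 3 ≤ ε ^ 2 := pow_le_pow_of_le_one hε.le hε1 (by norm_num)
      have h10 : ε ^ 3 * s ^ 2 ≤ q ^ 2 := by
        calc ε ^ 3 * s ^ 2 ≤ ε ^ 2 * s ^ 2 := by gcongr
          _ = 1 ^ 2 * ε ^ 2 * s ^ 2 := by ring
          _ ≤ c ^ 2 * ε ^ 2 * s ^ 2 := by gcongr
          _ = q ^ 2 := by rw [hq, ← sq_abs s]; ring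
      nlinarith [pow_pos hε 3]
  · have htn : ‖t‖ ≤ 1 := norm_airyPath_le_one h
    have hT := norm_exp_neg_sub_sum_le hc0 hε.le ht htn 3
    rw [← hζ, hc3] at hT
    simp only [Finset.sum_range_succ, Finset.sum_range_zero, Nat.factorial] at hT
    norm_num at hT
    have h1 : (1 + ζ + ζ ^ 2 / 2 - Complex.exp ζ).re ≤ 1 / 3 * ε ^ 3 := by
      refine (Complex.re_le_norm _).trans ?_
      rwa [← norm_neg, neg_sub]
    refine h1.trans ?_
    gcongr
    linarith [(sq_le_one_iff_abs_le_one s).2 h]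

theorem norm_exp_saddleExponent_le (hc1 : 1 ≤ c) (hc : c ≤ 2) (hc3 : c ^ 3 = 2) (hε : 0 < ε)
    (hε1 : ε ≤ 1) (s : ℝ) :
    ‖Complex.exp (saddleExponent c τ ε (airyPath (Real.pi / 3) s))‖ ≤
      Real.exp (1 - s ^ 2 / 8 + 2 * ‖τ‖ * (1 + |s|)) := by
  refine norm_exp_le_of_re_le (re_saddle_le hc1 hc3 hε hε1 s) ?_
  have hc0 : 0 ≤ c := by linarith
  have ht : 0 ≤ (airyPath (Real.pi / 3) s).re := by rw [re_airyPath]; positivity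
  have hT := norm_exp_neg_sub_sum_le hc0 hε.le ht (norm_airyPath_le s) 1
  simp only [Finset.sum_range_one, pow_zero, Nat.factorial_zero, Nat.cast_one, div_one, pow_one,
    Nat.factorial_one] at hT
  rw [norm_div, norm_mul, Complex.norm_real, Real.norm_of_nonneg hε.le, div_le_iff₀ hε]
  calc _ ≤ ‖τ‖ * (c * ε * (1 + |s|)) := by gcongr
    _ ≤ ‖τ‖ * (2 * ε * (1 + |s|)) := by gcongr
    _ = _ := by ring

theorem exists_norm_comp_exp_sub_le {F : ℂ → ℂ} (hF : Differentiable ℂ F) (hc0 : 0 ≤ c)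
    (hc : c ≤ 2) (K : ℝ) (hK : 0 ≤ K) :
    ∃ L : ℝ, 0 ≤ L ∧ ∀ ε : ℝ, 0 < ε → ε ≤ 1 → ∀ a : ℂ, ‖a‖ ≤ 2 → ‖a - 1‖ ≤ K * ε ^ 2 →
      ∀ (t : ℂ) (m : ℝ), 0 ≤ t.re → ‖t‖ ≤ m → 1 ≤ m →
        ‖F (a * Complex.exp (-(c * ε * t))) - F 1 + c * ε * t * deriv F 1‖ ≤ L * ε ^ 2 * m ^ 2 := by
  obtain ⟨L, hL0, hL⟩ := hF.exists_norm_sub_sub_deriv_mul_le 1 2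
  refine ⟨L * (K + 2) ^ 2 + ‖deriv F 1‖ * (K + 2), by positivity, ?_⟩
  intro ε hε hε1 a ha ha1 t m ht htm hm
  have hm0 : 0 ≤ m := by linarith
  have h1 := norm_exp_neg_sub_sum_le hc0 hε.le ht htm 1
  have h2 := norm_exp_neg_sub_sum_le hc0 hε.le ht htm 2
  simp only [Finset.sum_range_succ, Finset.sum_range_zero, pow_zero, Nat.factorial_zero,
    Nat.cast_one, div_one, pow_one, Nat.factorial_one, zero_add, Nat.factorial_two,
    Nat.cast_ofNat] at h1 h2
  have hE : ‖Complex.exp (-((c : ℂ) * ε * t))‖ ≤ 1 := by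
    rw [Complex.norm_exp]
    exact Real.exp_le_one_iff.2 (re_neg_mul_mul_nonpos hc0 hε.le ht)
  set e := Complex.exp (-((c : ℂ) * ε * t))
  have hae : ‖(a - 1) * e‖ ≤ K * ε ^ 2 := by
    rw [norm_mul]
    exact (mul_le_of_le_one_right (norm_nonneg _) hE).trans ha1
  have hp : ‖a * e - 1‖ ≤ (K + 2) * ε * m := by
    calc ‖a * e - 1‖ = ‖(a - 1) * e + (e - 1)‖ := by ring_nf
      _ ≤ K * ε ^ 2 + c * ε * m := (norm_add_le _ _).trans (add_le_add hae h1)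
      _ ≤ K * (ε * m) + 2 * ε * m := by
        gcongr
        nlinarith
      _ = _ := by ring
  have hp2 : ‖a * e - 1 + c * ε * t‖ ≤ (K + 2) * ε ^ 2 * m ^ 2 := by
    have hc2 : c ^ 2 / 2 ≤ 2 := by
      have : c ^ 2 ≤ 2 ^ 2 := by gcongr
      linarith
    calc ‖a * e - 1 + c * ε * t‖ = ‖(a - 1) * e + (e - (1 + -(c * ε * t)))‖ := by ring_nf
      _ ≤ K * ε ^ 2 + c ^ 2 / 2 * ε ^ 2 * m ^ 2 := (norm_add_le _ _).trans (add_le_add hae h2)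
      _ ≤ K * ε ^ 2 * m ^ 2 + 2 * ε ^ 2 * m ^ 2 := by
        refine add_le_add (le_mul_of_one_le_right (by positivity) (one_le_pow₀ hm)) ?_
        gcongr
      _ = _ := by ring
  have hnorm : ‖a * e‖ ≤ 2 := by
    rw [norm_mul]
    exact (mul_le_of_le_one_right (norm_nonneg _) hE).trans ha
  calc ‖F (a * e) - F 1 + c * ε * t * deriv F 1‖
      = ‖(F (a * e) - F 1 - deriv F 1 * (a * e - 1)) +
          deriv F 1 * (a * e - 1 + c * ε * t)‖ := by ring_nf
    _ ≤ L * ‖a * e - 1‖ ^ 2 + ‖deriv F 1‖ * ‖a * e - 1 + c * ε * t‖ := by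
      refine (norm_add_le _ _).trans (add_le_add (hL _ hnorm) (norm_mul_le _ _))
    _ ≤ L * ((K + 2) * ε * m) ^ 2 + ‖deriv F 1‖ * ((K + 2) * ε ^ 2 * m ^ 2) := by gcongr
    _ = _ := by ring

/-- First-order expansion of the integrand along the contour, with dominated error. -/
theorem exists_norm_integrand_sub_le {F : ℂ → ℂ} (hF : Differentiable ℂ F) (τ : ℂ)
    (hc1 : 1 ≤ c) (hc : c ≤ 2) (hc3 : c ^ 3 = 2) (K : ℝ) (hK : 0 ≤ K) :
    ∃ L : ℝ, ∀ ε : ℝ, 0 < ε → ε ≤ 1 → ∀ a : ℂ, ‖a‖ ≤ 2 → ‖a - 1‖ ≤ K * ε ^ 2 → ∀ s : ℝ,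
      ∀ t : ℂ, t = airyPath (Real.pi / 3) s →
      ‖Complex.exp (saddleExponent c τ ε t) * F (a * Complex.exp (-(c * ε * t))) -
        Complex.exp (-(c * τ) * t + t ^ 3 / 3) *
          (F 1 + ε * (saddleCorrection c τ t * F 1 - c * t * deriv F 1))‖ ≤
        L * ε ^ 2 * ((1 + |s|) ^ 8 * Real.exp (1 - s ^ 2 / 8 + 2 * ‖τ‖ * (1 + |s|))) := by
  have hc0 : 0 ≤ c := by linarith
  obtain ⟨L, hL0, hL⟩ := exists_norm_comp_exp_sub_le hF hc0 hc K hK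
  refine ⟨L + ((1 + 2 * ‖τ‖) ^ 2 + (1 + 2 * ‖τ‖)) * ‖F 1‖ +
    (1 + 2 * ‖τ‖) * (2 * ‖deriv F 1‖), ?_⟩
  intro ε hε hε1 a ha ha1 s t htdef
  have ht : 0 ≤ t.re := by rw [htdef, re_airyPath]; positivity
  have htm : ‖t‖ ≤ 1 + |s| := htdef ▸ norm_airyPath_le s
  have hm : 1 ≤ 1 + |s| := by linarith [abs_nonneg s]
  have hA : ‖Complex.exp (saddleExponent c τ ε t)‖ ≤
      Real.exp (1 - s ^ 2 / 8 + 2 * ‖τ‖ * (1 + |s|)) :=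
    htdef ▸ norm_exp_saddleExponent_le hc1 hc hc3 hε hε1 s
  have hB : ‖Complex.exp (-(c * τ) * t + t ^ 3 / 3)‖ ≤
      Real.exp (1 - s ^ 2 / 8 + 2 * ‖τ‖ * (1 + |s|)) := by
    rw [htdef]
    refine norm_airyPath_exp_le ?_ s
    rw [norm_mul, Complex.norm_real, Real.norm_of_nonneg hc0]
    gcongr
  have hd := norm_saddleExponent_sub_le (τ := τ) hc0 hc hc3 hε ht htm hm
  have hd2 := norm_saddleExponent_sub_sub_le (τ := τ) hc0 hc hc3 hε ht htm hm
  have hFb := hL ε hε hε1 a ha ha1 t (1 + |s|) ht htm hm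
  set M := Real.exp (1 - s ^ 2 / 8 + 2 * ‖τ‖ * (1 + |s|))
  have hM0 : 0 ≤ M := (norm_nonneg _).trans hA
  set m := 1 + |s|
  set A := saddleExponent c τ ε t
  set B := -(c * τ) * t + t ^ 3 / 3
  set h1 := saddleCorrection c τ t
  set Fa := F (a * Complex.exp (-(c * ε * t)))
  have hE1 := norm_exp_sub_exp_le hA hB
  have hE2 := norm_exp_sub_exp_mul_one_add_le (h := ε * h1) hA hB
  set C1 := 1 + 2 * ‖τ‖ with hC1
  have hC10 : 0 ≤ C1 := by positivity
  have hm0 : 0 ≤ m := by linarith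
  have hm2 : m ^ 2 ≤ m ^ 8 := pow_le_pow_right₀ hm (by norm_num)
  have hm5 : m ^ 5 ≤ m ^ 8 := pow_le_pow_right₀ hm (by norm_num)
  have e : Complex.exp A * Fa - Complex.exp B * (F 1 + ε * (h1 * F 1 - c * t * deriv F 1)) =
      Complex.exp A * (Fa - F 1 + c * ε * t * deriv F 1) +
      (Complex.exp A - Complex.exp B * (1 + ε * h1)) * F 1 -
      (Complex.exp A - Complex.exp B) * (c * ε * t * deriv F 1) := by ring
  have b1 : ‖Complex.exp A * (Fa - F 1 + c * ε * t * deriv F 1)‖ ≤ M * (L * ε ^ 2 * m ^ 8) := by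
    rw [norm_mul]
    have : ‖Fa - F 1 + c * ε * t * deriv F 1‖ ≤ L * ε ^ 2 * m ^ 8 := hFb.trans (by gcongr)
    gcongr
  have b2 : ‖(Complex.exp A - Complex.exp B * (1 + ε * h1)) * F 1‖ ≤
      M * ((C1 * ε * m ^ 4) ^ 2 + C1 * ε ^ 2 * m ^ 8) * ‖F 1‖ := by
    rw [norm_mul]
    have h5 : C1 * ε ^ 2 * m ^ 5 ≤ C1 * ε ^ 2 * m ^ 8 := by gcongr
    refine mul_le_mul_of_nonneg_right (hE2.trans ?_) (norm_nonneg _)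
    gcongr
    exact hd2.trans h5
  have b3 : ‖(Complex.exp A - Complex.exp B) * (c * ε * t * deriv F 1)‖ ≤
      M * (C1 * ε * m ^ 4) * (2 * ε * m * ‖deriv F 1‖) := by
    rw [norm_mul, norm_mul (c * ε * t : ℂ), ← norm_neg (c * ε * t : ℂ),
      norm_neg_mul_mul hc0 hε.le]
    refine mul_le_mul (hE1.trans (by gcongr)) (by gcongr) (by positivity) (by positivity)
  have b3' : M * (C1 * ε * m ^ 4) * (2 * ε * m * ‖deriv F 1‖) ≤
      M * (C1 * (2 * ‖deriv F 1‖)) * ε ^ 2 * m ^ 8 := by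
    calc _ = M * (C1 * (2 * ‖deriv F 1‖)) * ε ^ 2 * m ^ 5 := by ring
      _ ≤ _ := by gcongr
  rw [e]
  refine (norm_sub_le _ _).trans ?_
  refine (add_le_add ((norm_add_le _ _).trans (add_le_add b1 b2)) (b3.trans b3')).trans
    (le_of_eq ?_)
  ring

end Saddle

/-- First-order expansion of the saddle-point integral in terms of the moments of the Airy
integrand. -/
theorem exists_norm_integral_sub_airyMoment_le {F : ℂ → ℂ} (hF : Differentiable ℂ F) (τ : ℂ)
    {c : ℝ} (hc1 : 1 ≤ c) (hc : c ≤ 2) (hc3 : c ^ 3 = 2) (K : ℝ) (hK : 0 ≤ K) :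
    ∃ C : ℝ, ∀ ε : ℝ, 0 < ε → ε ≤ 1 → ∀ a : ℂ, ‖a‖ ≤ 2 → ‖a - 1‖ ≤ K * ε ^ 2 →
      ‖(∫ s : ℝ, Complex.exp (saddleExponent c τ ε (airyPath (Real.pi / 3) s)) *
          F (a * Complex.exp (-(c * ε * airyPath (Real.pi / 3) s))) *
          airyPathDeriv (Real.pi / 3) s) -
        (F 1 * airyMoment 0 (c * τ) +
          ε * (F 1 * (-(c / 12) * airyMoment 4 (c * τ) + τ * c ^ 2 / 2 * airyMoment 2 (c * τ)) -
            c * deriv F 1 * airyMoment 1 (c * τ)))‖ ≤ C * ε ^ 2 := by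
  obtain ⟨L, hL⟩ := exists_norm_integrand_sub_le hF τ hc1 hc hc3 K hK
  have hI := integrable_one_add_abs_pow_mul_exp 8 1 (2 * ‖τ‖)
  refine ⟨L * ∫ s : ℝ, (1 + |s|) ^ 8 * Real.exp (1 - s ^ 2 / 8 + 2 * ‖τ‖ * (1 + |s|)), ?_⟩
  intro ε hε hε1 a ha ha1
  have hFc := hF.continuous
  set H : ℝ → ℂ := fun s => Complex.exp (saddleExponent c τ ε (airyPath (Real.pi / 3) s)) *
    F (a * Complex.exp (-(c * ε * airyPath (Real.pi / 3) s))) * airyPathDeriv (Real.pi / 3) s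
    with hH
  set G : ℝ → ℂ := fun s =>
    Complex.exp (-(c * τ) * airyPath (Real.pi / 3) s + airyPath (Real.pi / 3) s ^ 3 / 3) *
      (F 1 + ε * (saddleCorrection c τ (airyPath (Real.pi / 3) s) * F 1 -
        c * airyPath (Real.pi / 3) s * deriv F 1)) * airyPathDeriv (Real.pi / 3) s with hG
  set i : ℕ → ℝ → ℂ := fun k s => airyPath (Real.pi / 3) s ^ k *
    Complex.exp (-(c * τ) * airyPath (Real.pi / 3) s + airyPath (Real.pi / 3) s ^ 3 / 3) *
      airyPathDeriv (Real.pi / 3) s with hi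
  have hii : ∀ k (b : ℂ), Integrable fun s => b * i k s := fun k b =>
    (integrable_airyMoment k (c * τ)).const_mul b
  have hG4 : G = (((fun s => F 1 * i 0 s) + fun s => ε * F 1 * -(c / 12) * i 4 s) +
      fun s => ε * F 1 * (τ * c ^ 2 / 2) * i 2 s) + fun s => -(ε * (c * deriv F 1)) * i 1 s := by
    ext s
    simp only [hG, hi, saddleCorrection, Pi.add_apply]
    ring
  have h04 := (hii 0 (F 1)).add (hii 4 (ε * F 1 * -(c / 12)))
  have h042 := h04.add (hii 2 (ε * F 1 * (τ * c ^ 2 / 2)))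
  have hGi : Integrable G := hG4 ▸ h042.add (hii 1 _)
  have hGint : ∫ s, G s = F 1 * airyMoment 0 (c * τ) +
      ε * (F 1 * (-(c / 12) * airyMoment 4 (c * τ) + τ * c ^ 2 / 2 * airyMoment 2 (c * τ)) -
        c * deriv F 1 * airyMoment 1 (c * τ)) := by
    have hm : ∀ k (b : ℂ), ∫ s, b * i k s = b * airyMoment k (c * τ) := fun k b =>
      integral_const_mul b _
    rw [hG4, integral_add' h042 (hii 1 _), integral_add' h04 (hii 2 _),
      integral_add' (hii 0 _) (hii 4 _), hm, hm, hm, hm]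
    ring
  have hb : ∀ s, ‖H s - G s‖ ≤
      L * ε ^ 2 * ((1 + |s|) ^ 8 * Real.exp (1 - s ^ 2 / 8 + 2 * ‖τ‖ * (1 + |s|))) := by
    intro s
    refine le_trans (le_of_eq_of_le ?_ (norm_mul_airyPathDeriv_le _ (Real.pi / 3) s))
      (hL ε hε hε1 a ha ha1 s _ rfl)
    simp only [hH, hG, sub_mul]
  have hHm : AEStronglyMeasurable H := aestronglyMeasurable_airyPath
    (g := fun t => Complex.exp (saddleExponent c τ ε t) * F (a * Complex.exp (-(c * ε * t))))
    (by unfold saddleExponent; fun_prop)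
  have hHG : Integrable fun s => H s - G s :=
    (hI.const_mul (L * ε ^ 2)).mono' (hHm.sub hGi.aestronglyMeasurable) (Eventually.of_forall hb)
  have hHi : Integrable H := (hHG.add hGi).congr (Eventually.of_forall fun s => by simp)
  rw [← hGint, ← integral_sub hHi hGi]
  refine (norm_integral_le_of_norm_le (hI.const_mul (L * ε ^ 2)) (Eventually.of_forall hb)).trans ?_
  rw [integral_const_mul]
  exact le_of_eq (by ring)

/-- First-order expansion of the saddle-point integral in terms of the Airy function. -/
theorem exists_norm_integral_sub_airyAi_le {F : ℂ → ℂ} (hF : Differentiable ℂ F) (τ : ℂ)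
    {c : ℝ} (hc1 : 1 ≤ c) (hc : c ≤ 2) (hc3 : c ^ 3 = 2) (K : ℝ) (hK : 0 ≤ K) :
    ∃ C : ℝ, ∀ ε : ℝ, 0 < ε → ε ≤ 1 → ∀ a : ℂ, ‖a‖ ≤ 2 → ‖a - 1‖ ≤ K * ε ^ 2 →
      ‖1 / (2 * (Real.pi : ℂ) * Complex.I) *
          (∫ s : ℝ, Complex.exp (saddleExponent c τ ε (airyPath (Real.pi / 3) s)) *
            F (a * Complex.exp (-(c * ε * airyPath (Real.pi / 3) s))) *
            airyPathDeriv (Real.pi / 3) s) -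
        (F 1 * airyAi (c * τ) + ε * ((5 / 6 : ℂ) * τ ^ 2 * F 1 * airyAi (c * τ) -
          (1 / 6 : ℂ) * c * F 1 * airyAi' (c * τ) + c * deriv F 1 * airyAi' (c * τ)))‖ ≤
        C * ε ^ 2 := by
  obtain ⟨C, hC⟩ := exists_norm_integral_sub_airyMoment_le hF τ hc1 hc hc3 K hK
  refine ⟨‖1 / (2 * (Real.pi : ℂ) * Complex.I)‖ * C, ?_⟩
  intro ε hε hε1 a ha ha1
  have h := mul_le_mul_of_nonneg_left (hC ε hε hε1 a ha ha1)
    (norm_nonneg (1 / (2 * (Real.pi : ℂ) * Complex.I)))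
  rw [← norm_mul, mul_sub, ← mul_assoc (‖_‖)] at h
  refine le_of_eq_of_le (congrArg _ ?_) h
  have hc3' : (c : ℂ) ^ 3 = 2 := by exact_mod_cast hc3
  rw [airyAi_eq_airyMoment, airyAi'_eq_airyMoment, airyMoment_two, airyMoment_four]
  generalize 1 / (2 * (Real.pi : ℂ) * Complex.I) = p
  linear_combination (5 / 12 * ε * τ ^ 2 * F 1 * p * airyMoment 0 (c * τ)) * hc3'

/-- The contour integral for `φ_0` at the double saddle point. -/
theorem phiR_zero_eq_integral_airyPath {F : ℂ → ℂ} (hF : Differentiable ℂ F) (τ : ℂ)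
    {c ε : ℝ} (hc1 : 1 ≤ c) (hc : c ≤ 2) (hε : 0 < ε) (hε1 : ε ≤ 1) (V : ℝ) :
    phiR 0 ((1 - τ * (ε : ℂ) ^ 2) / (Real.exp 1 * ε ^ 3 : ℝ)) (ε ^ 3) V F =
      1 / (Real.sqrt (2 * Real.pi * ε ^ 3) : ℂ) * (-Complex.I * (c * ε)) *
        Complex.exp (-1 / (2 * (ε : ℂ) ^ 3) + τ / ε) *
        ∫ s : ℝ, Complex.exp (saddleExponent c τ ε (airyPath (Real.pi / 3) s)) *
          F ((1 - τ * (ε : ℂ) ^ 2) * (V / (ε : ℂ) ^ 3) *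
            Complex.exp (-(c * ε * airyPath (Real.pi / 3) s))) *
          airyPathDeriv (Real.pi / 3) s := by
  have hεc : (ε : ℂ) ≠ 0 := by exact_mod_cast hε.ne'
  set z : ℂ := (1 - τ * (ε : ℂ) ^ 2) / (Real.exp 1 * ε ^ 3 : ℝ) with hz
  have he : Complex.exp 1 ≠ 0 := Complex.exp_ne_zero _
  have hze : z * Complex.exp 1 = (1 - τ * (ε : ℂ) ^ 2) / (ε : ℂ) ^ 3 := by
    rw [hz]
    push_cast
    field_simp
  set f : ℂ → ℂ := fun x =>
    Complex.exp (-x ^ 2 / (2 * (ε : ℂ) ^ 3) - z * Complex.exp (-Complex.I * x)) *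
      F (z * V * Complex.exp (-Complex.I * x)) with hf
  have hfd : Differentiable ℂ f := by
    have := hF
    fun_prop
  obtain ⟨B, hB⟩ := (isCompact_closedBall (0 : ℂ) (‖z * V‖ * Real.exp 1)).exists_bound_of_continuousOn
    hF.continuous.continuousOn
  have hb : ∀ x : ℂ, x.im ≤ 1 → 3 * x.im ^ 2 ≤ x.re ^ 2 + 3 →
      ‖f x‖ ≤ Real.exp (1 / (2 * ε ^ 3)) * Real.exp (‖z‖ * Real.exp 1) * B *
        Real.exp (-(1 / (3 * ε ^ 3)) * x.re ^ 2) := by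
    intro x hx1 hx2
    have hE : ‖Complex.exp (-Complex.I * x)‖ ≤ Real.exp 1 := by
      rw [Complex.norm_exp]
      simpa using hx1
    have hFb : ‖F (z * V * Complex.exp (-Complex.I * x))‖ ≤ B := by
      refine hB _ (mem_closedBall_zero_iff.2 ?_)
      rw [norm_mul]
      gcongr
    have h1 : ‖Complex.exp (-x ^ 2 / (2 * (ε : ℂ) ^ 3))‖ ≤
        Real.exp (1 / (2 * ε ^ 3)) * Real.exp (-(1 / (3 * ε ^ 3)) * x.re ^ 2) := by
      have hre : (-x ^ 2 / (2 * (ε : ℂ) ^ 3)).re = (x.im ^ 2 - x.re ^ 2) / (2 * ε ^ 3) := by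
        have : (2 * (ε : ℂ) ^ 3) = ((2 * ε ^ 3 : ℝ) : ℂ) := by push_cast; rfl
        rw [this, Complex.div_ofReal_re, Complex.neg_re, pow_two, Complex.mul_re]
        ring
      rw [Complex.norm_exp, hre, ← Real.exp_add, Real.exp_le_exp]
      have : 1 / (2 * ε ^ 3) + -(1 / (3 * ε ^ 3)) * x.re ^ 2 =
        (1 - 2 / 3 * x.re ^ 2) / (2 * ε ^ 3) := by
        field_simp
        ring
      rw [this]
      exact div_le_div_of_nonneg_right (by linarith) (by positivity)
    have h2 : ‖Complex.exp (-(z * Complex.exp (-Complex.I * x)))‖ ≤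
        Real.exp (‖z‖ * Real.exp 1) := by
      refine (Complex.norm_exp_le_exp_norm _).trans (Real.exp_le_exp.2 ?_)
      rw [norm_neg, norm_mul]
      gcongr
    rw [hf]
    simp only [sub_eq_add_neg, Complex.exp_add, norm_mul]
    calc _ ≤ Real.exp (1 / (2 * ε ^ 3)) * Real.exp (-(1 / (3 * ε ^ 3)) * x.re ^ 2) *
          Real.exp (‖z‖ * Real.exp 1) * B := by
          simp only [← norm_mul]
          rw [norm_mul, norm_mul]
          gcongr
      _ = _ := by ring
  have hdef := integral_real_eq_integral_airyPath hfd (κ := c * ε) (by positivity)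
    (by nlinarith) (by positivity) hb
  have hphi : phiR 0 z (ε ^ 3) V F =
      1 / (Real.sqrt (2 * Real.pi * ε ^ 3) : ℂ) * ∫ x : ℝ, f x := by
    simp [phiR, hf]
  rw [hphi, hdef, ← integral_const_mul, ← integral_const_mul]
  refine integral_congr_ae (Eventually.of_forall fun s => ?_)
  beta_reduce
  set t := airyPath (Real.pi / 3) s
  have hx : -Complex.I * (Complex.I * (1 - ((c * ε : ℝ) : ℂ) * t)) = 1 + -(c * ε * t) := by
    push_cast
    linear_combination (-(1 - c * ε * t)) * Complex.I_mul_I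
  have hx2 : (Complex.I * (1 - ((c * ε : ℝ) : ℂ) * t)) ^ 2 = -(1 - c * ε * t) ^ 2 := by
    rw [mul_pow, Complex.I_sq]
    push_cast
    ring
  have harg : z * V * Complex.exp (1 + -(c * ε * t)) =
      (1 - τ * (ε : ℂ) ^ 2) * (V / (ε : ℂ) ^ 3) * Complex.exp (-(c * ε * t)) := by
    rw [Complex.exp_add]
    linear_combination V * Complex.exp (-(c * ε * t)) * hze
  have hexp : - -(1 - c * ε * t) ^ 2 / (2 * (ε : ℂ) ^ 3) - z * Complex.exp (1 + -(c * ε * t)) =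
      (-1 / (2 * (ε : ℂ) ^ 3) + τ / ε) + saddleExponent c τ ε t := by
    have : z * Complex.exp (1 + -(c * ε * t)) =
        (1 - τ * (ε : ℂ) ^ 2) / (ε : ℂ) ^ 3 * Complex.exp (-(c * ε * t)) := by
      rw [Complex.exp_add]
      linear_combination Complex.exp (-(c * ε * t)) * hze
    rw [this, saddleExponent]
    field_simp
    ring
  simp only [hf, hx, hx2, harg, hexp]
  rw [Complex.exp_add]
  push_cast
  ring

theorem one_div_sqrt_two_pi_mul_cube (c : ℝ) {ε : ℝ} (hε : 0 < ε) :
    1 / (Real.sqrt (2 * Real.pi * ε ^ 3) : ℂ) * (-Complex.I * (c * ε)) =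
      Real.sqrt (2 * Real.pi) * c * ((Real.sqrt ε)⁻¹ : ℝ) *
        (1 / (2 * (Real.pi : ℂ) * Complex.I)) := by
  have h1 : Real.sqrt (2 * Real.pi * ε ^ 3) = Real.sqrt (2 * Real.pi) * (ε * Real.sqrt ε) := by
    rw [Real.sqrt_mul (by positivity : 0 ≤ 2 * Real.pi), show ε ^ 3 = ε ^ 2 * ε by ring,
      Real.sqrt_mul (sq_nonneg ε), Real.sqrt_sq hε.le]
  have h2 : (Real.sqrt (2 * Real.pi) : ℂ) ^ 2 = 2 * Real.pi := by
    exact_mod_cast Real.sq_sqrt (show 0 ≤ 2 * Real.pi by positivity)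
  have h3 : (Real.sqrt (2 * Real.pi) : ℂ) ≠ 0 := by
    exact_mod_cast (show Real.sqrt (2 * Real.pi) ≠ 0 by positivity)
  have h4 : (Real.sqrt ε : ℂ) ≠ 0 := by exact_mod_cast (show Real.sqrt ε ≠ 0 by positivity)
  have h5 : (ε : ℂ) ≠ 0 := by exact_mod_cast hε.ne'
  have h6 : (Real.pi : ℂ) ≠ 0 := by exact_mod_cast Real.pi_ne_zero
  rw [h1, ← h2]
  push_cast
  field_simp
  linear_combination (-(c : ℂ)) * Complex.I_sq

/-- The rescaled argument of `F` is close to `1` at the saddle point. -/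
theorem norm_one_sub_mul_div_sub_one_le (τ : ℂ) {ε V K : ℝ} (hε : 0 < ε) (hε1 : ε ≤ 1)
    (hV : |V - ε ^ 3| ≤ K * (ε ^ 3) ^ 2) :
    ‖(1 - τ * (ε : ℂ) ^ 2) * (V / (ε : ℂ) ^ 3) - 1‖ ≤ ((1 + ‖τ‖) * K + ‖τ‖) * ε ^ 2 := by
  have hεc : (ε : ℂ) ≠ 0 := by exact_mod_cast hε.ne'
  have hK : 0 ≤ K := by
    have := (abs_nonneg _).trans hV
    exact nonneg_of_mul_nonneg_left this (by positivity)
  have h1 : ‖(V : ℂ) / (ε : ℂ) ^ 3 - 1‖ ≤ K * ε ^ 2 := by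
    have : (V : ℂ) / (ε : ℂ) ^ 3 - 1 = ((V - ε ^ 3 : ℝ) : ℂ) / (ε : ℂ) ^ 3 := by
      push_cast
      field_simp
    rw [this, norm_div, norm_pow, Complex.norm_real, Complex.norm_real, Real.norm_eq_abs,
      Real.norm_of_nonneg hε.le, div_le_iff₀ (by positivity)]
    calc |V - ε ^ 3| ≤ K * (ε ^ 5 * ε) := by convert hV using 2; ring
      _ ≤ K * (ε ^ 5 * 1) := by gcongr
      _ = _ := by ring
  have h2 : ‖τ * (ε : ℂ) ^ 2‖ = ‖τ‖ * ε ^ 2 := by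
    rw [norm_mul, norm_pow, Complex.norm_real, Real.norm_of_nonneg hε.le]
  have h3 : ‖1 - τ * (ε : ℂ) ^ 2‖ ≤ 1 + ‖τ‖ := by
    refine (norm_sub_le _ _).trans ?_
    rw [norm_one, h2]
    gcongr
    exact mul_le_of_le_one_right (norm_nonneg _) (pow_le_one₀ hε.le hε1)
  calc _ = ‖(1 - τ * (ε : ℂ) ^ 2) * ((V : ℂ) / (ε : ℂ) ^ 3 - 1) - τ * (ε : ℂ) ^ 2‖ := by ring_nf
    _ ≤ (1 + ‖τ‖) * (K * ε ^ 2) + ‖τ‖ * ε ^ 2 := by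
      refine (norm_sub_le _ _).trans ?_
      rw [norm_mul, h2]
      gcongr
    _ = _ := by ring

/-- Refined part (c) estimate for `φ_0`: with `z(w) = (1 − τw^{2/3})/(ew)`,
`φ_0 = √(2π) 2^{1/3} w^{−1/6} K_0(τ,w) e^{−1/(2w) + τ/w^{1/3}}` where
`K_0(τ,w) = F(1)Ai(2^{1/3}τ) + w^{1/3}((5/6)τ²F(1)Ai(2^{1/3}τ)
− (1/6)2^{1/3}F(1)Ai'(2^{1/3}τ) + 2^{1/3}F'(1)Ai'(2^{1/3}τ)) + O(w^{2/3})`. -/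
theorem phiR0_refined_part_c (F : ℂ → ℂ) (hF : Differentiable ℂ F)
    (hFne : ∀ x : ℂ, x ≠ 0 → F x ≠ 0)
    (W : ℝ → ℝ) (hW : (fun w => W w - w) =O[𝓝[>] (0 : ℝ)] fun w => w ^ 2)
    (τ : ℂ) :
    ∃ E : ℝ → ℂ,
      (E =O[𝓝[>] (0 : ℝ)] fun w => w ^ ((2 : ℝ) / 3)) ∧
      ∀ᶠ w in 𝓝[>] (0 : ℝ),
        phiR 0 ((1 - τ * ((w ^ ((2 : ℝ) / 3) : ℝ) : ℂ)) / ((Real.exp 1 * w : ℝ) : ℂ))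
            w (W w) F =
          (Real.sqrt (2 * Real.pi) : ℂ) * (2 : ℂ) ^ ((1 : ℂ) / 3) *
            ((w ^ (-(1 : ℝ) / 6) : ℝ) : ℂ) *
            (F 1 * airyAi ((2 : ℂ) ^ ((1 : ℂ) / 3) * τ)
              + ((w ^ ((1 : ℝ) / 3) : ℝ) : ℂ) *
                ((5 / 6 : ℂ) * τ ^ 2 * F 1 * airyAi ((2 : ℂ) ^ ((1 : ℂ) / 3) * τ)
                  - (1 / 6 : ℂ) * (2 : ℂ) ^ ((1 : ℂ) / 3) * F 1 *
                    airyAi' ((2 : ℂ) ^ ((1 : ℂ) / 3) * τ)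
                  + (2 : ℂ) ^ ((1 : ℂ) / 3) * deriv F 1 *
                    airyAi' ((2 : ℂ) ^ ((1 : ℂ) / 3) * τ))
              + E w) *
            Complex.exp (-1 / (2 * (w : ℂ)) + τ / ((w ^ ((1 : ℝ) / 3) : ℝ) : ℂ)) := by
  obtain ⟨c, hcdef⟩ : ∃ c : ℝ, c = (2 : ℝ) ^ ((1 : ℝ) / 3) := ⟨_, rfl⟩
  have hcc : (2 : ℂ) ^ ((1 : ℂ) / 3) = c := by
    rw [hcdef, Complex.ofReal_cpow (by norm_num)]
    norm_num
  have hc3 : c ^ 3 = 2 := by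
    rw [hcdef, ← Real.rpow_natCast, ← Real.rpow_mul (by norm_num)]
    norm_num
  have hc1 : 1 ≤ c := hcdef ▸ Real.one_le_rpow (by norm_num) (by norm_num)
  have hc2 : c ≤ 2 := hcdef ▸ Real.rpow_le_self_of_one_le (by norm_num) (by norm_num)
  rw [hcc]
  obtain ⟨K, hK, hWK⟩ := hW.exists_pos
  rw [Asymptotics.isBigOWith_iff] at hWK
  have hK1 : 0 ≤ (1 + ‖τ‖) * K + ‖τ‖ := by positivity
  obtain ⟨C, hC⟩ := exists_norm_integral_sub_airyAi_le hF τ hc1 hc2 hc3 _ hK1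
  have htend : Tendsto (fun w : ℝ => w ^ ((1 : ℝ) / 3)) (𝓝[>] 0) (𝓝 0) :=
    ((Real.continuous_rpow_const (by norm_num)).tendsto' 0 0 (by norm_num)).mono_left
      nhdsWithin_le_nhds
  have htend2 : Tendsto (fun w : ℝ => ((1 + ‖τ‖) * K + ‖τ‖) * (w ^ ((1 : ℝ) / 3)) ^ 2)
      (𝓝[>] 0) (𝓝 0) := by
    simpa using (htend.pow 2).const_mul ((1 + ‖τ‖) * K + ‖τ‖)
  have hpow : ∀ w : ℝ, 0 < w → (w ^ ((1 : ℝ) / 3)) ^ 3 = w ∧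
      w ^ ((2 : ℝ) / 3) = (w ^ ((1 : ℝ) / 3)) ^ 2 ∧
      w ^ (-(1 : ℝ) / 6) = (Real.sqrt (w ^ ((1 : ℝ) / 3)))⁻¹ := by
    intro w hw
    refine ⟨?_, ?_, ?_⟩
    · rw [← Real.rpow_natCast, ← Real.rpow_mul hw.le]
      norm_num
    · rw [← Real.rpow_natCast, ← Real.rpow_mul hw.le]
      norm_num
    · rw [Real.sqrt_eq_rpow, ← Real.rpow_mul hw.le, ← Real.rpow_neg hw.le]
      norm_num
  refine ⟨fun w => 1 / (2 * (Real.pi : ℂ) * Complex.I) *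
      (∫ s : ℝ, Complex.exp (saddleExponent c τ (w ^ ((1 : ℝ) / 3)) (airyPath (Real.pi / 3) s)) *
        F ((1 - τ * ((w ^ ((1 : ℝ) / 3) : ℝ) : ℂ) ^ 2) *
            (W w / ((w ^ ((1 : ℝ) / 3) : ℝ) : ℂ) ^ 3) *
          Complex.exp (-(c * (w ^ ((1 : ℝ) / 3) : ℝ) * airyPath (Real.pi / 3) s))) *
        airyPathDeriv (Real.pi / 3) s) -
      (F 1 * airyAi (c * τ) + ((w ^ ((1 : ℝ) / 3) : ℝ) : ℂ) *
        ((5 / 6 : ℂ) * τ ^ 2 * F 1 * airyAi (c * τ) -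
          (1 / 6 : ℂ) * c * F 1 * airyAi' (c * τ) + c * deriv F 1 * airyAi' (c * τ))), ?_, ?_⟩
  · refine Asymptotics.IsBigO.of_bound C ?_
    filter_upwards [self_mem_nhdsWithin, hWK, htend.eventually_le_const one_pos,
      htend2.eventually_le_const one_pos] with w hw hWw hε1 hKε
    obtain ⟨h3, h2, -⟩ := hpow w hw
    have hε : 0 < w ^ ((1 : ℝ) / 3) := Real.rpow_pos_of_pos hw _
    rw [h2, Real.norm_of_nonneg (by positivity)]
    have hV : |W w - (w ^ ((1 : ℝ) / 3)) ^ 3| ≤ K * ((w ^ ((1 : ℝ) / 3)) ^ 3) ^ 2 := by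
      rw [h3]
      simpa using hWw
    have ha1 := norm_one_sub_mul_div_sub_one_le τ hε hε1 hV
    refine hC _ hε hε1 _ ?_ ha1
    have ha := norm_le_norm_add_norm_sub' ((1 - τ * ((w ^ ((1 : ℝ) / 3) : ℝ) : ℂ) ^ 2) *
      (W w / ((w ^ ((1 : ℝ) / 3) : ℝ) : ℂ) ^ 3)) 1
    rw [norm_one] at ha
    linarith
  · filter_upwards [self_mem_nhdsWithin, htend.eventually_le_const one_pos] with w hw hε1
    obtain ⟨h3, h2, h6⟩ := hpow w hw
    have hε : 0 < w ^ ((1 : ℝ) / 3) := Real.rpow_pos_of_pos hw _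
    have hphi := phiR_zero_eq_integral_airyPath hF τ hc1 hc2 hε hε1 (W w)
    rw [one_div_sqrt_two_pi_mul_cube c hε] at hphi
    rw [h2, h6]
    set ε := w ^ ((1 : ℝ) / 3)
    generalize W w = V at hphi ⊢
    rw [← h3]
    push_cast at hphi ⊢
    rw [hphi]
    ring
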